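/- arXiv:2004.06975 — 4 statements merged into one kernel-verified Lean document; each statement's English description precedes it below -/
import Mathlib

section
/- Let m > 0 and for each n ≥ 1 let X be a random vector uniformly distributed on the sphere of radius √n in ℝⁿ, let Z̃ ∈ ℝⁿ have i.i.d. standard Gaussian entries independent of X, and set Ỹ = √m · X + Z̃. Define the average free entropy f̃ₙ = (1/n) E ln ∫ exp( √m · ⟨x, Ỹ⟩ − (m/2)‖x‖² ) dP_x(x), where P_x is the uniform probability measure on the sphere of radius √n in ℝⁿ. Then lim_{n→∞} f̃ₙ = m/2 − ln(1+m)/2. Equivalently, the average mutual information between X and Ỹ satisfies lim_{n→∞} I(X;Ỹ)/n = ln(1+m)/2. -/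
open MeasureTheory Real Filter

noncomputable section

/-- i.i.d. standard Gaussian measure on `Fin n → ℝ`. -/
def stdGaussian (n : ℕ) : Measure (Fin n → ℝ) :=
  Measure.pi fun _ : Fin n => ProbabilityTheory.gaussianReal 0 1

/-- `P` is the uniform (rotation-invariant) probability measure on the sphere of
radius `r` centered at the origin in `ℝⁿ`. -/
def IsUniformSphere (n : ℕ) (r : ℝ) (P : Measure (Fin n → ℝ)) : Prop :=
  IsProbabilityMeasure P ∧
  (∀ᵐ x ∂P, ∑ i, (x i) ^ 2 = r ^ 2) ∧
  ∀ O : Matrix (Fin n) (Fin n) ℝ, O ∈ Matrix.orthogonalGroup (Fin n) ℝ →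
    P.map (fun x => O.mulVec x) = P

/-- The average free entropy `f̃ₙ` of the Gaussian channel `Ỹ = √m X + Z̃` where the
signal `X ~ P` is uniform on the sphere of radius `√n` in `ℝⁿ`:
`f̃ₙ = (1/n) E ln ∫ exp(√m ⟨x,Ỹ⟩ − (m/2)‖x‖²) dP(x)`. -/
def sphericalFreeEntropy (m : ℝ) (n : ℕ) (P : Measure (Fin n → ℝ)) : ℝ :=
  (1 / (n : ℝ)) *
    ∫ X, (∫ Z,
        Real.log (∫ x,
          Real.exp (Real.sqrt m * (∑ i, x i * (Real.sqrt m * X i + Z i))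
            - m / 2 * ∑ i, (x i) ^ 2) ∂P)
      ∂(stdGaussian n)) ∂P

open ProbabilityTheory (gaussianReal gaussianPDF)

open scoped ENNReal

instance isProbabilityMeasure_stdGaussian (n : ℕ) : IsProbabilityMeasure (stdGaussian n) := by
  unfold stdGaussian; infer_instance

lemma lintegral_gaussianReal_exp_quadratic (b c : ℝ) (hc : -1 < c) :
    ∫⁻ x, ENNReal.ofReal (exp (b * x - c / 2 * x ^ 2)) ∂(gaussianReal 0 1) =
      ENNReal.ofReal (exp (b ^ 2 / (2 * (1 + c))) / √(1 + c)) := by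
  have hc' : 0 < 1 + c := by linarith
  obtain ⟨v, hvc⟩ : ∃ v : NNReal, (v : ℝ) = (1 + c)⁻¹ :=
    ⟨((1 + c)⁻¹).toNNReal, Real.coe_toNNReal _ (by positivity)⟩
  have hv : v ≠ 0 := by
    rintro rfl
    exact (inv_pos.2 hc').ne hvc
  rw [ProbabilityTheory.gaussianReal_of_var_ne_zero _ one_ne_zero,
    lintegral_withDensity_eq_lintegral_mul _ (ProbabilityTheory.measurable_gaussianPDF _ _)
      (by fun_prop)]
  have key : ∀ x, (gaussianPDF 0 1 * fun x => ENNReal.ofReal (exp (b * x - c / 2 * x ^ 2))) x =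
      ENNReal.ofReal (exp (b ^ 2 / (2 * (1 + c))) / √(1 + c)) *
        gaussianPDF (b / (1 + c)) v x := by
    intro x
    simp only [Pi.mul_apply, ProbabilityTheory.gaussianPDF_def]
    rw [← ENNReal.ofReal_mul (ProbabilityTheory.gaussianPDFReal_nonneg _ _ _),
      ← ENNReal.ofReal_mul (by positivity)]
    congr 1
    simp only [ProbabilityTheory.gaussianPDFReal_def, NNReal.coe_one, hvc]
    have h1 : √(2 * π * (1 + c)⁻¹) = √(2 * π * 1) / √(1 + c) := by
      rw [← Real.sqrt_div (by positivity)]; congr 1; field_simp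
    have hs : √(1 + c) ≠ 0 := by positivity
    have hs' : √(2 * π * 1) ≠ 0 := by positivity
    have h2 : rexp (-(x - 0) ^ 2 / (2 * 1)) * rexp (b * x - c / 2 * x ^ 2) =
        rexp (b ^ 2 / (2 * (1 + c))) * rexp (-(x - b / (1 + c)) ^ 2 / (2 * (1 + c)⁻¹)) := by
      rw [← exp_add, ← exp_add]
      congr 1
      field_simp
      ring
    rw [h1, mul_assoc, h2]
    field_simp
  simp_rw [key]
  rw [lintegral_const_mul _ (ProbabilityTheory.measurable_gaussianPDF _ _),
    ProbabilityTheory.lintegral_gaussianPDF_eq_one _ hv, mul_one]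

lemma gaussianReal_withDensity_exp (b : ℝ) :
    (gaussianReal 0 1).withDensity (fun x => ENNReal.ofReal (exp (b * x - b ^ 2 / 2))) =
      gaussianReal b 1 := by
  rw [ProbabilityTheory.gaussianReal_of_var_ne_zero _ one_ne_zero,
    ProbabilityTheory.gaussianReal_of_var_ne_zero _ one_ne_zero,
    ← withDensity_mul _ (ProbabilityTheory.measurable_gaussianPDF _ _) (by fun_prop)]
  congr 1
  ext x
  simp only [Pi.mul_apply, ProbabilityTheory.gaussianPDF_def]
  rw [← ENNReal.ofReal_mul (ProbabilityTheory.gaussianPDFReal_nonneg _ _ _)]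
  congr 1
  simp only [ProbabilityTheory.gaussianPDFReal_def, NNReal.coe_one]
  rw [mul_assoc, ← exp_add]
  congr 2
  ring

lemma lintegral_stdGaussian_prod {n : ℕ} (f : Fin n → ℝ → ℝ≥0∞) (hf : ∀ i, Measurable (f i)) :
    ∫⁻ x, ∏ i, f i (x i) ∂(stdGaussian n) = ∏ i, ∫⁻ x, f i x ∂(gaussianReal 0 1) := by
  rw [stdGaussian, ProbabilityTheory.lintegral_prod_eq_prod_lintegral_of_indepFun _ (fun i (x : Fin n → ℝ) => f i (x i))
    (ProbabilityTheory.iIndepFun_pi fun i => (hf i).aemeasurable)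
    (fun i => (hf i).comp (measurable_pi_apply i))]
  refine Finset.prod_congr rfl fun i _ => ?_
  exact (measurePreserving_eval (fun _ : Fin n => gaussianReal 0 1) i).lintegral_comp (hf i)

/-- The Cameron-Martin formula for the standard Gaussian measure. -/
lemma lintegral_stdGaussian_add {n : ℕ} (a : Fin n → ℝ) {F : (Fin n → ℝ) → ℝ≥0∞}
    (hF : Measurable F) :
    ∫⁻ z, F (fun i => a i + z i) ∂(stdGaussian n) =
      ∫⁻ z, ENNReal.ofReal (exp (∑ i, a i * z i - (∑ i, a i ^ 2) / 2)) * F z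
        ∂(stdGaussian n) := by
  have h1 : (stdGaussian n).map (fun z i => a i + z i) =
      Measure.pi fun i => gaussianReal (a i) 1 := by
    rw [stdGaussian, Measure.pi_map_pi (f := fun i x => a i + x) (by fun_prop)]
    simp only [ProbabilityTheory.gaussianReal_map_const_add, zero_add]
  have h2 : (Measure.pi fun i => gaussianReal (a i) 1) = (stdGaussian n).withDensity
      (fun z => ENNReal.ofReal (exp (∑ i, a i * z i - (∑ i, a i ^ 2) / 2))) := by
    refine Measure.pi_eq fun s hs => ?_
    rw [withDensity_apply _ (MeasurableSet.univ_pi hs),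
      ← lintegral_indicator (MeasurableSet.univ_pi hs)]
    have h3 : ∀ i, gaussianReal (a i) 1 (s i) = ∫⁻ x, (s i).indicator
        (fun x => ENNReal.ofReal (exp (a i * x - a i ^ 2 / 2))) x ∂(gaussianReal 0 1) := fun i => by
      rw [lintegral_indicator (hs i), ← withDensity_apply _ (hs i), gaussianReal_withDensity_exp]
    simp_rw [h3]
    rw [← lintegral_stdGaussian_prod _ fun i => Measurable.indicator (by fun_prop) (hs i)]
    refine lintegral_congr fun z => ?_
    by_cases hz : z ∈ Set.univ.pi s
    · have hz' : ∀ i, z i ∈ s i := fun i => hz i (Set.mem_univ i)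
      simp only [Set.indicator_of_mem hz, Set.indicator_of_mem (hz' _)]
      rw [← ENNReal.ofReal_prod_of_nonneg fun i _ => (exp_pos _).le, ← exp_sum,
        Finset.sum_sub_distrib, Finset.sum_div]
    · rw [Set.indicator_of_notMem hz]
      simp only [Set.mem_univ_pi, not_forall] at hz
      obtain ⟨i, hi⟩ := hz
      exact (Finset.prod_eq_zero (Finset.mem_univ i) (Set.indicator_of_notMem hi _)).symm
  rw [← lintegral_map hF (by fun_prop), h1, h2,
    lintegral_withDensity_eq_lintegral_mul _ (by fun_prop) hF]
  rfl

lemma lintegral_stdGaussian_exp_quadratic {n : ℕ} (b : Fin n → ℝ) (c : ℝ) (hc : -1 < c) :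
    ∫⁻ z, ENNReal.ofReal (exp (∑ i, b i * z i - c / 2 * ∑ i, z i ^ 2)) ∂(stdGaussian n) =
      ENNReal.ofReal (exp ((∑ i, b i ^ 2) / (2 * (1 + c)) - n / 2 * log (1 + c))) := by
  have hc' : 0 < 1 + c := by linarith
  have h1 : ∀ z : Fin n → ℝ, ENNReal.ofReal (exp (∑ i, b i * z i - c / 2 * ∑ i, z i ^ 2)) =
      ∏ i, ENNReal.ofReal (exp (b i * z i - c / 2 * z i ^ 2)) := by
    intro z
    rw [← ENNReal.ofReal_prod_of_nonneg fun i _ => (exp_pos _).le, ← exp_sum,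
      Finset.sum_sub_distrib, Finset.mul_sum]
  simp_rw [h1]
  rw [lintegral_stdGaussian_prod (fun i x => ENNReal.ofReal (exp (b i * x - c / 2 * x ^ 2)))
    (fun i => by fun_prop)]
  simp_rw [lintegral_gaussianReal_exp_quadratic _ c hc]
  rw [← ENNReal.ofReal_prod_of_nonneg fun i _ => by positivity]
  congr 1
  have h2 : √(1 + c) = exp (log (1 + c) / 2) := by
    rw [Real.sqrt_eq_rpow, Real.rpow_def_of_pos hc']; congr 1; ring
  simp_rw [h2, ← exp_sub]
  rw [← exp_sum, Finset.sum_sub_distrib, ← Finset.sum_div]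
  simp
  ring_nf

lemma memLp_gaussianReal_quadratic (u v w : ℝ) :
    MemLp (fun x => u + v * x + w * x ^ 2) 2 (gaussianReal 0 1) := by
  have h4 : MemLp (fun x : ℝ => x) 4 (gaussianReal 0 1) :=
    ProbabilityTheory.memLp_id_gaussianReal' 4 (by simp)
  have h2 : MemLp (fun x : ℝ => x) 2 (gaussianReal 0 1) :=
    ProbabilityTheory.memLp_id_gaussianReal' 2 (by simp)
  have hsq : MemLp (fun x : ℝ => x ^ 2) 2 (gaussianReal 0 1) := by
    rw [memLp_two_iff_integrable_sq (by fun_prop)]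
    have := h4.integrable_norm_pow (p := 4) (by norm_num)
    refine this.congr (ae_of_all _ fun x => ?_)
    simp only [norm_eq_abs]
    rw [← pow_mul]
    exact (Even.pow_abs (by decide) x)
  exact ((memLp_const u).add (h2.const_mul v)).add (hsq.const_mul w)

lemma integral_gaussianReal_sq : ∫ x, x ^ 2 ∂(gaussianReal 0 1) = 1 := by
  have h := ProbabilityTheory.variance_fun_id_gaussianReal (μ := 0) (v := 1)
  rw [ProbabilityTheory.variance_eq_integral (by fun_prop)] at h
  simpa using h

/-- The second moment of `x² - 1` under the standard Gaussian measure. -/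
def gaussianSqFluctuation : ℝ := ∫ x, (x ^ 2 - 1) ^ 2 ∂(gaussianReal 0 1)

lemma gaussianSqFluctuation_nonneg : 0 ≤ gaussianSqFluctuation :=
  integral_nonneg fun _ => sq_nonneg _

lemma integral_gaussianReal_centered_sq (a σ : ℝ) :
    ∫ x, ((a + σ * x) ^ 2 - (a ^ 2 + σ ^ 2)) ∂(gaussianReal 0 1) = 0 := by
  have h1 : Integrable (fun x : ℝ => 2 * a * σ * x) (gaussianReal 0 1) :=
    ((memLp_gaussianReal_quadratic 0 (2 * a * σ) 0).integrable (by norm_num)).congr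
      (ae_of_all _ fun x => by simp)
  have h2 : Integrable (fun x : ℝ => σ ^ 2 * x ^ 2) (gaussianReal 0 1) :=
    ((memLp_gaussianReal_quadratic 0 0 (σ ^ 2)).integrable (by norm_num)).congr
      (ae_of_all _ fun x => by simp)
  have h3 : ∀ x : ℝ, (a + σ * x) ^ 2 - (a ^ 2 + σ ^ 2) =
      2 * a * σ * x + σ ^ 2 * x ^ 2 - σ ^ 2 := fun x => by ring
  simp_rw [h3]
  rw [integral_sub (by exact h1.add h2) (integrable_const _), integral_add h1 h2,
    integral_const_mul, integral_const_mul, ProbabilityTheory.integral_id_gaussianReal,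
    integral_gaussianReal_sq]
  simp

lemma variance_gaussianReal_centered_sq_le (a σ : ℝ) :
    ProbabilityTheory.variance (fun x => (a + σ * x) ^ 2 - (a ^ 2 + σ ^ 2)) (gaussianReal 0 1) ≤
      8 * σ ^ 2 * a ^ 2 + 2 * σ ^ 4 * gaussianSqFluctuation := by
  refine (ProbabilityTheory.variance_le_expectation_sq (by fun_prop)).trans ?_
  have h1 : Integrable (fun x : ℝ => 8 * σ ^ 2 * a ^ 2 * x ^ 2) (gaussianReal 0 1) :=
    ((memLp_gaussianReal_quadratic 0 0 (8 * σ ^ 2 * a ^ 2)).integrable (by norm_num)).congr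
      (ae_of_all _ fun x => by simp)
  have h2 : Integrable (fun x : ℝ => 2 * σ ^ 4 * (x ^ 2 - 1) ^ 2) (gaussianReal 0 1) :=
    ((memLp_gaussianReal_quadratic (-1) 0 1).integrable_sq.const_mul (2 * σ ^ 4)).congr
      (ae_of_all _ fun x => by simp; ring_nf; simp)
  have h3 : MemLp (fun x => (a + σ * x) ^ 2 - (a ^ 2 + σ ^ 2)) 2 (gaussianReal 0 1) := by
    convert memLp_gaussianReal_quadratic (-σ ^ 2) (2 * a * σ) (σ ^ 2) using 2
    ring
  calc _ ≤ ∫ x, (8 * σ ^ 2 * a ^ 2 * x ^ 2 + 2 * σ ^ 4 * (x ^ 2 - 1) ^ 2) ∂(gaussianReal 0 1) := by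
        refine integral_mono h3.integrable_sq (h1.add h2) fun x => ?_
        simp only [Pi.pow_apply]
        nlinarith [sq_nonneg (2 * a * σ * x - σ ^ 2 * (x ^ 2 - 1))]
    _ = _ := by
        rw [integral_add h1 h2, integral_const_mul, integral_const_mul, integral_gaussianReal_sq,
          mul_one, gaussianSqFluctuation]

lemma memLp_sum_centered_sq {n : ℕ} (a : Fin n → ℝ) (σ : ℝ) :
    MemLp (fun z => ∑ i, (a i + σ * z i) ^ 2 - (∑ i, a i ^ 2 + n * σ ^ 2)) 2 (stdGaussian n) := by
  have h : MemLp (fun z : Fin n → ℝ => ∑ i, ((a i + σ * z i) ^ 2 - (a i ^ 2 + σ ^ 2))) 2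
      (stdGaussian n) := by
    refine memLp_finsetSum _ fun i _ => ?_
    have h3 : MemLp (fun x => (a i + σ * x) ^ 2 - (a i ^ 2 + σ ^ 2)) 2 (gaussianReal 0 1) := by
      convert memLp_gaussianReal_quadratic (-σ ^ 2) (2 * a i * σ) (σ ^ 2) using 2
      ring
    exact h3.comp_measurePreserving
      (measurePreserving_eval (fun _ : Fin n => gaussianReal 0 1) i)
  convert h using 2 with z
  simp [Finset.sum_sub_distrib, Finset.sum_add_distrib]

lemma integral_sum_centered_sq {n : ℕ} (a : Fin n → ℝ) (σ : ℝ) :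
    ∫ z, (∑ i, (a i + σ * z i) ^ 2 - (∑ i, a i ^ 2 + n * σ ^ 2)) ∂(stdGaussian n) = 0 := by
  have h : ∀ z : Fin n → ℝ, ∑ i, (a i + σ * z i) ^ 2 - (∑ i, a i ^ 2 + n * σ ^ 2) =
      ∑ i, ((a i + σ * z i) ^ 2 - (a i ^ 2 + σ ^ 2)) := fun z => by
    simp [Finset.sum_sub_distrib, Finset.sum_add_distrib]
  have h3 : ∀ i, MemLp (fun x => (a i + σ * x) ^ 2 - (a i ^ 2 + σ ^ 2)) 2 (gaussianReal 0 1) := by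
    intro i
    convert memLp_gaussianReal_quadratic (-σ ^ 2) (2 * a i * σ) (σ ^ 2) using 2
    ring
  simp_rw [h]
  rw [integral_finsetSum]
  · refine Finset.sum_eq_zero fun i _ => ?_
    rw [← integral_gaussianReal_centered_sq (a i) σ]
    exact integral_comp_eval (μ := fun _ : Fin n => gaussianReal 0 1)
      (h3 i).aestronglyMeasurable
  · exact fun i _ => ((h3 i).comp_measurePreserving
      (measurePreserving_eval (fun _ : Fin n => gaussianReal 0 1) i)).integrable (by norm_num)

lemma integral_sum_centered_sq_sq_le {n : ℕ} (a : Fin n → ℝ) (σ : ℝ) :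
    ∫ z, (∑ i, (a i + σ * z i) ^ 2 - (∑ i, a i ^ 2 + n * σ ^ 2)) ^ 2 ∂(stdGaussian n) ≤
      8 * σ ^ 2 * ∑ i, a i ^ 2 + n * (2 * σ ^ 4 * gaussianSqFluctuation) := by
  have h3 : ∀ i, MemLp (fun x => (a i + σ * x) ^ 2 - (a i ^ 2 + σ ^ 2)) 2 (gaussianReal 0 1) := by
    intro i
    convert memLp_gaussianReal_quadratic (-σ ^ 2) (2 * a i * σ) (σ ^ 2) using 2
    ring
  have hv := ProbabilityTheory.variance_sum_pi h3
  have h : (∑ i, fun ω : Fin n → ℝ => (a i + σ * ω i) ^ 2 - (a i ^ 2 + σ ^ 2)) =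
      fun z => ∑ i, (a i + σ * z i) ^ 2 - (∑ i, a i ^ 2 + n * σ ^ 2) := by
    ext z
    simp [Finset.sum_sub_distrib, Finset.sum_add_distrib]
  rw [h, ProbabilityTheory.variance_eq_integral (Measurable.aemeasurable (by fun_prop))] at hv
  have h0 := integral_sum_centered_sq a σ
  rw [stdGaussian] at h0 ⊢
  rw [h0] at hv
  simp only [sub_zero] at hv
  rw [hv]
  refine (Finset.sum_le_sum fun i _ => variance_gaussianReal_centered_sq_le (a i) σ).trans ?_
  simp [Finset.sum_add_distrib, Finset.mul_sum]

lemma exists_orthogonalGroup_mulVec_eq {n : ℕ} {y y' : Fin n → ℝ}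
    (h : ∑ i, y i ^ 2 = ∑ i, y' i ^ 2) :
    ∃ O ∈ Matrix.orthogonalGroup (Fin n) ℝ, O.mulVec y = y' := by
  by_cases hy : y = y'
  · exact ⟨1, one_mem _, by simp [hy]⟩
  have hw : y - y' ≠ 0 := sub_ne_zero.2 hy
  set w := y - y' with hwdef
  have hk : w ⬝ᵥ w ≠ 0 := fun h0 => hw (dotProduct_self_eq_zero.1 h0)
  have h' : y ⬝ᵥ y = y' ⬝ᵥ y' := by simpa [dotProduct, pow_two] using h
  have hkw : w ⬝ᵥ w = 2 * (w ⬝ᵥ y) := by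
    simp only [hwdef, sub_dotProduct, dotProduct_sub, dotProduct_comm y' y]
    linarith
  refine ⟨1 - (2 / (w ⬝ᵥ w)) • Matrix.vecMulVec w w, ?_, ?_⟩
  · rw [Matrix.mem_orthogonalGroup_iff, Matrix.transpose_sub, Matrix.transpose_one,
      Matrix.transpose_smul, Matrix.transpose_vecMulVec, sub_mul, mul_sub, mul_sub]
    simp only [mul_one, one_mul, Matrix.smul_mul, Matrix.mul_smul,
      Matrix.vecMulVec_mul_vecMulVec, Matrix.vecMulVec_smul, smul_smul]
    rw [div_mul_cancel₀ _ hk]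
    module
  · rw [Matrix.sub_mulVec, Matrix.one_mulVec, Matrix.smul_mulVec, Matrix.vecMulVec_mulVec]
    ext i
    have : 2 / (w ⬝ᵥ w) * (w ⬝ᵥ y) = 1 := by
      have hne : w ⬝ᵥ y ≠ 0 := fun h0 => hk (by rw [hkw, h0, mul_zero])
      rw [hkw]
      field_simp
    simp only [Pi.sub_apply, Pi.smul_apply, smul_eq_mul, MulOpposite.smul_eq_mul_unop,
      MulOpposite.unop_op]
    rw [mul_left_comm, this, hwdef]
    simp

/-- The partition function `∫ exp (s ⟨x, y⟩) dP(x)`. -/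
def partitionFunction {n : ℕ} (s : ℝ) (P : Measure (Fin n → ℝ)) (y : Fin n → ℝ) : ℝ :=
  ∫ x, exp (s * ∑ i, x i * y i) ∂P

section Sphere

variable {n : ℕ} {r s : ℝ} {P : Measure (Fin n → ℝ)}

lemma abs_sum_mul_le_of_sq_sum_eq {x : Fin n → ℝ} (hr : 0 ≤ r) (hx : ∑ i, x i ^ 2 = r ^ 2)
    (y : Fin n → ℝ) : |∑ i, x i * y i| ≤ r * √(∑ i, y i ^ 2) := by
  rw [← Real.sqrt_sq hr, ← Real.sqrt_mul (sq_nonneg r), ← hx]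
  exact Real.abs_le_sqrt (Finset.sum_mul_sq_le_sq_mul_sq _ _ _)

lemma IsUniformSphere.integrable_exp (hP : IsUniformSphere n r P) (hr : 0 ≤ r) (hs : 0 ≤ s)
    (y : Fin n → ℝ) : Integrable (fun x => exp (s * ∑ i, x i * y i)) P := by
  have := hP.1
  refine Integrable.of_bound (Measurable.aestronglyMeasurable (by fun_prop))
    (exp (s * (r * √(∑ i, y i ^ 2)))) ?_
  filter_upwards [hP.2.1] with x hx
  rw [norm_of_nonneg (exp_pos _).le, exp_le_exp]
  exact mul_le_mul_of_nonneg_left ((le_abs_self _).trans (abs_sum_mul_le_of_sq_sum_eq hr hx y)) hs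

lemma IsUniformSphere.partitionFunction_pos (hP : IsUniformSphere n r P) (hr : 0 ≤ r)
    (hs : 0 ≤ s) (y : Fin n → ℝ) : 0 < partitionFunction s P y := by
  have := hP.1
  exact integral_exp_pos (hP.integrable_exp hr hs y)

lemma measurable_partitionFunction [SFinite P] : Measurable (partitionFunction s P) := by
  unfold partitionFunction
  refine (StronglyMeasurable.integral_prod_right
    (f := fun (y x : Fin n → ℝ) => exp (s * ∑ i, x i * y i)) ?_).measurable
  exact Measurable.stronglyMeasurable (by simp only [Function.uncurry_def]; fun_prop)

lemma IsUniformSphere.ofReal_partitionFunction (hP : IsUniformSphere n r P) (hr : 0 ≤ r)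
    (hs : 0 ≤ s) (y : Fin n → ℝ) :
    ENNReal.ofReal (partitionFunction s P y) =
      ∫⁻ x, ENNReal.ofReal (exp (s * ∑ i, x i * y i)) ∂P :=
  ofReal_integral_eq_lintegral_ofReal (hP.integrable_exp hr hs y)
    (ae_of_all _ fun _ => (exp_pos _).le)

lemma IsUniformSphere.partitionFunction_eq (hP : IsUniformSphere n r P) {y y' : Fin n → ℝ}
    (h : ∑ i, y i ^ 2 = ∑ i, y' i ^ 2) : partitionFunction s P y = partitionFunction s P y' := by
  obtain ⟨O, hO, rfl⟩ := exists_orthogonalGroup_mulVec_eq h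
  have hmeas : Measurable fun x : Fin n → ℝ => O.mulVec x :=
    (Continuous.matrix_mulVec continuous_const continuous_id).measurable
  have hdot : ∀ x, ∑ i, O.mulVec x i * O.mulVec y i = ∑ i, x i * y i := fun x => by
    change O.mulVec x ⬝ᵥ O.mulVec y = x ⬝ᵥ y
    rw [Matrix.dotProduct_mulVec, Matrix.vecMul_mulVec]
    have : O.transpose * O = 1 := by
      simpa [Matrix.star_eq_conjTranspose] using (Matrix.mem_orthogonalGroup_iff' (Fin n) ℝ).1 hO
    rw [this, Matrix.vecMul_one]
  unfold partitionFunction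
  conv_rhs => rw [← hP.2.2 O hO]
  rw [integral_map hmeas.aemeasurable (Measurable.aestronglyMeasurable (by fun_prop))]
  simp_rw [hdot]

lemma IsUniformSphere.partitionFunction_le (hP : IsUniformSphere n r P) (hr : 0 ≤ r)
    (hs : 0 ≤ s) (y y' : Fin n → ℝ) :
    partitionFunction s P y ≤
      exp (s * (r * √(∑ i, (y i - y' i) ^ 2))) * partitionFunction s P y' := by
  unfold partitionFunction
  rw [← integral_const_mul]
  refine integral_mono_ae (hP.integrable_exp hr hs y)
    ((hP.integrable_exp hr hs y').const_mul _) ?_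
  filter_upwards [hP.2.1] with x hx
  rw [← exp_add, exp_le_exp, ← mul_add]
  refine mul_le_mul_of_nonneg_left ?_ hs
  have h := (le_abs_self _).trans (abs_sum_mul_le_of_sq_sum_eq hr hx fun i => y i - y' i)
  simp only [mul_sub, Finset.sum_sub_distrib] at h
  linarith

lemma IsUniformSphere.abs_log_partitionFunction_sub_le (hP : IsUniformSphere n r P)
    (hr : 0 ≤ r) (hs : 0 ≤ s) (y y' : Fin n → ℝ) :
    |log (partitionFunction s P y) - log (partitionFunction s P y')| ≤
      s * (r * √(∑ i, (y i - y' i) ^ 2)) := by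
  have key : ∀ u v, log (partitionFunction s P u) - log (partitionFunction s P v) ≤
      s * (r * √(∑ i, (u i - v i) ^ 2)) := fun u v => by
    have h := log_le_log (hP.partitionFunction_pos hr hs u) (hP.partitionFunction_le hr hs u v)
    rw [log_mul (exp_pos _).ne' (hP.partitionFunction_pos hr hs v).ne', log_exp] at h
    linarith
  refine abs_sub_le_iff.2 ⟨key y y', ?_⟩
  have := key y' y
  simp_rw [sub_sq_comm] at this
  exact this

lemma abs_sqrt_sub_sqrt_le {u ρ : ℝ} (hu : 0 ≤ u) (hρ : 0 < ρ) :
    |√u - √ρ| ≤ ((u - ρ) ^ 2 / ρ + 1) / 2 := by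
  have h1 : |√u - √ρ| * √ρ ≤ |u - ρ| := by
    have : u - ρ = (√u - √ρ) * (√u + √ρ) := by
      ring_nf
      rw [Real.sq_sqrt hu, Real.sq_sqrt hρ.le]
    rw [this, abs_mul, abs_of_nonneg (by positivity : 0 ≤ √u + √ρ)]
    exact mul_le_mul_of_nonneg_left (by linarith [Real.sqrt_nonneg u]) (abs_nonneg _)
  have h2 : (√u - √ρ) ^ 2 ≤ (u - ρ) ^ 2 / ρ := by
    rw [le_div_iff₀ hρ, ← sq_abs (u - ρ), ← sq_abs (√u - √ρ)]
    calc |√u - √ρ| ^ 2 * ρ = (|√u - √ρ| * √ρ) ^ 2 := by rw [mul_pow, Real.sq_sqrt hρ.le]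
      _ ≤ _ := by gcongr
  have h3 := sq_nonneg (|√u - √ρ| - 1)
  rw [sub_sq, sq_abs] at h3
  linarith

lemma IsUniformSphere.abs_log_partitionFunction_sub_le_radial (hP : IsUniformSphere n r P)
    (hr : 0 ≤ r) (hs : 0 ≤ s) (y : Fin n → ℝ) {y₀ : Fin n → ℝ} {ρ : ℝ} (hρ : 0 < ρ)
    (hy₀ : ∑ i, y₀ i ^ 2 = ρ) :
    |log (partitionFunction s P y) - log (partitionFunction s P y₀)| ≤
      s * r * (((∑ i, y i ^ 2 - ρ) ^ 2 / ρ + 1) / 2) := by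
  have hu : 0 ≤ ∑ i, y i ^ 2 := Finset.sum_nonneg fun i _ => sq_nonneg _
  set t := √(∑ i, y i ^ 2) / √ρ
  have hsρ : 0 < √ρ := Real.sqrt_pos.2 hρ
  have h1 : ∑ i, y i ^ 2 = ∑ i, (t * y₀ i) ^ 2 := by
    simp_rw [mul_pow, ← Finset.mul_sum, hy₀, t, div_pow, Real.sq_sqrt hu, Real.sq_sqrt hρ.le]
    field_simp
  have h2 : ∑ i, (t * y₀ i - y₀ i) ^ 2 = (√(∑ i, y i ^ 2) - √ρ) ^ 2 := by
    have : ∀ i, (t * y₀ i - y₀ i) ^ 2 = (t - 1) ^ 2 * y₀ i ^ 2 := fun i => by ring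
    simp_rw [this, ← Finset.mul_sum, hy₀]
    rw [← Real.sq_sqrt hρ.le, ← mul_pow, Real.sq_sqrt hρ.le, sub_mul, one_mul,
      div_mul_cancel₀ _ hsρ.ne']
  rw [hP.partitionFunction_eq h1]
  refine (hP.abs_log_partitionFunction_sub_le hr hs _ _).trans ?_
  rw [h2, Real.sqrt_sq_eq_abs, mul_assoc]
  gcongr
  exact abs_sqrt_sub_sqrt_le hu hρ

lemma IsUniformSphere.integrable_log_partitionFunction (hP : IsUniformSphere n r P)
    (hr : 0 ≤ r) (hs : 0 ≤ s) (a : Fin n → ℝ) (σ : ℝ) {y₀ : Fin n → ℝ}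
    (hy₀ : ∑ i, y₀ i ^ 2 = ∑ i, a i ^ 2 + n * σ ^ 2) (hpos : 0 < ∑ i, a i ^ 2 + n * σ ^ 2) :
    Integrable (fun z => log (partitionFunction s P fun i => a i + σ * z i)) (stdGaussian n) ∧
    |∫ z, log (partitionFunction s P fun i => a i + σ * z i) ∂(stdGaussian n) -
      log (partitionFunction s P y₀)| ≤
      s * r * ((σ ^ 2 * (8 + 2 * gaussianSqFluctuation) + 1) / 2) := by
  have := hP.1
  set ρ := ∑ i, a i ^ 2 + n * σ ^ 2
  have hB : Integrable (fun z : Fin n → ℝ =>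
      s * r * (((∑ i, (a i + σ * z i) ^ 2 - ρ) ^ 2 / ρ + 1) / 2)) (stdGaussian n) :=
    ((((memLp_sum_centered_sq a σ).integrable_sq.div_const ρ).add
      (integrable_const 1)).div_const 2).const_mul (s * r)
  have hbound : ∀ z : Fin n → ℝ, ‖log (partitionFunction s P fun i => a i + σ * z i) -
      log (partitionFunction s P y₀)‖ ≤
        s * r * (((∑ i, (a i + σ * z i) ^ 2 - ρ) ^ 2 / ρ + 1) / 2) := fun z =>
    hP.abs_log_partitionFunction_sub_le_radial hr hs _ hpos hy₀
  have hmeas : Measurable fun z : Fin n → ℝ =>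
      log (partitionFunction s P fun i => a i + σ * z i) :=
    (measurable_partitionFunction.comp (by fun_prop)).log
  have hsub : Integrable (fun z => log (partitionFunction s P fun i => a i + σ * z i) -
      log (partitionFunction s P y₀)) (stdGaussian n) :=
    hB.mono' (hmeas.sub_const _).aestronglyMeasurable (ae_of_all _ hbound)
  have hint : Integrable (fun z => log (partitionFunction s P fun i => a i + σ * z i))
      (stdGaussian n) :=
    (hsub.add (integrable_const (log (partitionFunction s P y₀)))).congr
      (ae_of_all _ fun z => by simp)
  refine ⟨hint, ?_⟩
  have heq : ∫ z, log (partitionFunction s P fun i => a i + σ * z i) ∂(stdGaussian n) -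
      log (partitionFunction s P y₀) = ∫ z, (log (partitionFunction s P fun i => a i + σ * z i) -
      log (partitionFunction s P y₀)) ∂(stdGaussian n) := by
    rw [integral_sub hint (integrable_const _)]; simp
  rw [heq]
  refine (norm_integral_le_of_norm_le hB (ae_of_all _ hbound)).trans ?_
  rw [integral_const_mul, integral_div,
    integral_add ((memLp_sum_centered_sq a σ).integrable_sq.div_const ρ) (integrable_const 1),
    integral_div]
  have hvar := integral_sum_centered_sq_sq_le a σ
  have hle : (∫ z, (∑ i, (a i + σ * z i) ^ 2 - ρ) ^ 2 ∂(stdGaussian n)) / ρ ≤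
      σ ^ 2 * (8 + 2 * gaussianSqFluctuation) := by
    rw [div_le_iff₀ hpos]
    refine hvar.trans ?_
    have ha : 0 ≤ ∑ i, a i ^ 2 := Finset.sum_nonneg fun i _ => sq_nonneg _
    have h1 : 0 ≤ 8 * (n : ℝ) * σ ^ 4 := by positivity
    have h2 : 0 ≤ σ ^ 2 * gaussianSqFluctuation * ∑ i, a i ^ 2 :=
      mul_nonneg (mul_nonneg (sq_nonneg _) gaussianSqFluctuation_nonneg) ha
    simp only [ρ]
    linarith
  simp only [integral_const, probReal_univ, smul_eq_mul, mul_one]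
  gcongr

end Sphere

lemma integral_nonpos_of_lintegral_exp_le_one {α : Type*} [MeasurableSpace α] {μ : Measure α}
    [IsProbabilityMeasure μ] {g : α → ℝ} (hg : Integrable g μ)
    (h : ∫⁻ x, ENNReal.ofReal (exp (g x)) ∂μ ≤ 1) : ∫ x, g x ∂μ ≤ 0 := by
  have hmeas : AEStronglyMeasurable (fun x => exp (g x)) μ :=
    continuous_exp.comp_aestronglyMeasurable hg.aestronglyMeasurable
  have hnn : 0 ≤ᵐ[μ] fun x => exp (g x) := ae_of_all _ fun _ => (exp_pos _).le
  have hint : Integrable (fun x => exp (g x)) μ :=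
    (lintegral_ofReal_ne_top_iff_integrable hmeas hnn).1 (h.trans_lt ENNReal.one_lt_top).ne
  have h1 : ∫ x, exp (g x) ∂μ ≤ 1 := by
    rw [integral_eq_lintegral_of_nonneg_ae hnn hmeas]
    exact ENNReal.toReal_le_of_le_ofReal zero_le_one (by simpa using h)
  have h2 : ∫ x, (g x + 1) ∂μ ≤ ∫ x, exp (g x) ∂μ :=
    integral_mono (hg.add (integrable_const 1)) hint fun x => add_one_le_exp (g x)
  rw [integral_add hg (integrable_const 1)] at h2
  simp at h2
  linarith

section Channel

variable {n : ℕ} {m : ℝ} {P : Measure (Fin n → ℝ)}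

lemma IsUniformSphere.lintegral_gaussian_partitionFunction (hP : IsUniformSphere n (√n) P)
    (hm : 0 < m) :
    ∫⁻ z, ENNReal.ofReal (exp (log (partitionFunction √m P fun i => 0 + √(1 + m) * z i) -
      m * n / 2 + n / 2 * log (1 + m) - m / 2 * ∑ i, z i ^ 2)) ∂(stdGaussian n) = 1 := by
  have := hP.1
  have h1 : ∀ z : Fin n → ℝ,
      ENNReal.ofReal (exp (log (partitionFunction √m P fun i => 0 + √(1 + m) * z i) -
        m * n / 2 + n / 2 * log (1 + m) - m / 2 * ∑ i, z i ^ 2)) =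
      ∫⁻ x, ENNReal.ofReal (exp (∑ i, (√m * √(1 + m) * x i) * z i - m / 2 * ∑ i, z i ^ 2)) *
        ENNReal.ofReal (exp (n / 2 * log (1 + m) - m * n / 2)) ∂P := fun z => by
    have hpos := hP.partitionFunction_pos (by positivity) (Real.sqrt_nonneg m)
      fun i => 0 + √(1 + m) * z i
    rw [show ∀ a b c d : ℝ, a - b + c - d = a + (c - b - d) by intros; ring, exp_add,
      exp_log hpos, ENNReal.ofReal_mul hpos.le,
      hP.ofReal_partitionFunction (by positivity) (Real.sqrt_nonneg m),
      ← lintegral_mul_const _ (by fun_prop)]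
    refine lintegral_congr fun x => ?_
    rw [← ENNReal.ofReal_mul (exp_pos _).le, ← ENNReal.ofReal_mul (exp_pos _).le, ← exp_add,
      ← exp_add, Finset.mul_sum]
    have : ∀ i, √m * (x i * (0 + √(1 + m) * z i)) = √m * √(1 + m) * x i * z i := fun i => by ring
    simp_rw [this]
    ring_nf
  simp_rw [h1]
  rw [lintegral_lintegral_swap (Measurable.aemeasurable
    (by simp only [Function.uncurry_def]; fun_prop))]
  have h2 : ∀ᵐ x ∂P, ∫⁻ z, ENNReal.ofReal (exp (∑ i, (√m * √(1 + m) * x i) * z i -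
      m / 2 * ∑ i, z i ^ 2)) * ENNReal.ofReal (exp (n / 2 * log (1 + m) - m * n / 2))
        ∂(stdGaussian n) = 1 := by
    filter_upwards [hP.2.1] with x hx
    rw [lintegral_mul_const _ (by fun_prop),
      lintegral_stdGaussian_exp_quadratic (fun i => √m * √(1 + m) * x i) m (by linarith),
      ← ENNReal.ofReal_mul (exp_pos _).le, ← exp_add]
    simp_rw [mul_pow, ← Finset.mul_sum, hx, Real.sq_sqrt hm.le,
      Real.sq_sqrt (by linarith : 0 ≤ 1 + m), Real.sq_sqrt (Nat.cast_nonneg (α := ℝ) n)]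
    rw [show m * (1 + m) * n / (2 * (1 + m)) = m * n / 2 by field_simp]
    simp
  rw [lintegral_congr_ae h2]
  simp

lemma IsUniformSphere.exists_lintegral_shifted_le_one (hP : IsUniformSphere n (√n) P)
    (hm : 0 < m) :
    ∃ X : Fin n → ℝ, ∑ i, X i ^ 2 = n ∧
      ∫⁻ z, ENNReal.ofReal (exp (m / (2 * (1 + m)) * ∑ i, (√m * X i + z i) ^ 2 -
        n / 2 * log (1 + m) - log (partitionFunction √m P fun i => √m * X i + z i) +
        m * n / 2)) ∂(stdGaussian n) ≤ 1 := by
  have := hP.1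
  set V : (Fin n → ℝ) → ℝ := fun y => m / (2 * (1 + m)) * ∑ i, y i ^ 2 - n / 2 * log (1 + m) -
    log (partitionFunction √m P y) + m * n / 2
  have hVm : Measurable V :=
    (((by fun_prop : Measurable fun y : Fin n → ℝ => m / (2 * (1 + m)) * ∑ i, y i ^ 2 -
      n / 2 * log (1 + m))).sub measurable_partitionFunction.log).add_const _
  have hFm : Measurable fun y => ENNReal.ofReal (exp (V y)) := by fun_prop
  have hshift : ∀ᵐ X ∂P, ∫⁻ z, ENNReal.ofReal (exp (V fun i => √m * X i + z i)) ∂(stdGaussian n) =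
      ∫⁻ z, ENNReal.ofReal (exp (√m * ∑ i, X i * z i)) *
        ENNReal.ofReal (exp (V z - m * n / 2)) ∂(stdGaussian n) := by
    filter_upwards [hP.2.1] with X hX
    rw [lintegral_stdGaussian_add (fun i => √m * X i) hFm]
    refine lintegral_congr fun z => ?_
    rw [← ENNReal.ofReal_mul (exp_pos _).le, ← ENNReal.ofReal_mul (exp_pos _).le, ← exp_add,
      ← exp_add]
    simp_rw [mul_pow, mul_assoc, ← Finset.mul_sum, hX, Real.sq_sqrt hm.le,
      Real.sq_sqrt (Nat.cast_nonneg (α := ℝ) n)]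
    ring_nf
  have hprod : Measurable (Function.uncurry fun X z : Fin n → ℝ =>
      ENNReal.ofReal (exp (√m * ∑ i, X i * z i)) * ENNReal.ofReal (exp (V z - m * n / 2))) := by
    simp only [Function.uncurry_def]; fun_prop
  have htotal : ∫⁻ X, ∫⁻ z, ENNReal.ofReal (exp (√m * ∑ i, X i * z i)) *
      ENNReal.ofReal (exp (V z - m * n / 2)) ∂(stdGaussian n) ∂P = 1 := by
    rw [lintegral_lintegral_swap hprod.aemeasurable]
    have h1 : ∀ z, ∫⁻ X, ENNReal.ofReal (exp (√m * ∑ i, X i * z i)) *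
        ENNReal.ofReal (exp (V z - m * n / 2)) ∂P =
        ENNReal.ofReal (exp (∑ i, (0 : Fin n → ℝ) i * z i - (-(m / (1 + m))) / 2 *
          ∑ i, z i ^ 2)) * ENNReal.ofReal (exp (-(n / 2 * log (1 + m)))) := fun z => by
      have hpos := hP.partitionFunction_pos (by positivity) (Real.sqrt_nonneg m) z
      rw [lintegral_mul_const _ (by fun_prop),
        ← hP.ofReal_partitionFunction (by positivity) (Real.sqrt_nonneg m),
        ← ENNReal.ofReal_mul hpos.le, ← ENNReal.ofReal_mul (exp_pos _).le, ← exp_add]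
      nth_rewrite 1 [← exp_log hpos]
      rw [← exp_add]
      congr 2
      simp only [V, Pi.zero_apply, zero_mul, Finset.sum_const_zero]
      field_simp
      ring
    simp_rw [h1]
    have hc : 1 + -(m / (1 + m)) = (1 + m)⁻¹ := by field_simp; ring
    have hc' : 0 < (1 + m)⁻¹ := by positivity
    rw [lintegral_mul_const _ (by fun_prop),
      lintegral_stdGaussian_exp_quadratic _ _ (by linarith), hc, log_inv,
      ← ENNReal.ofReal_mul (exp_pos _).le, ← exp_add]
    simp
  obtain ⟨X, hX, hle⟩ := exists_notMem_null_le_lintegral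
    (hprod.lintegral_prod_right' (ν := stdGaussian n)).aemeasurable (ae_iff.1 (hP.2.1.and hshift))
  simp only [Set.mem_ofPred_eq, not_not] at hX
  refine ⟨X, by rw [hX.1, Real.sq_sqrt (Nat.cast_nonneg n)], ?_⟩
  change ∫⁻ z, ENNReal.ofReal (exp (V fun i => √m * X i + z i)) ∂(stdGaussian n) ≤ 1
  rw [hX.2, ← htotal]
  exact hle

lemma integrable_sum_sq (a : Fin n → ℝ) (σ : ℝ) :
    Integrable (fun z => ∑ i, (a i + σ * z i) ^ 2) (stdGaussian n) :=
  (((memLp_sum_centered_sq a σ).integrable (by norm_num)).add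
    (integrable_const (∑ i, a i ^ 2 + n * σ ^ 2))).congr (ae_of_all _ fun z => by simp)

lemma integral_sum_sq (a : Fin n → ℝ) (σ : ℝ) :
    ∫ z, ∑ i, (a i + σ * z i) ^ 2 ∂(stdGaussian n) = ∑ i, a i ^ 2 + n * σ ^ 2 := by
  have h := integral_sum_centered_sq a σ
  rw [integral_sub (integrable_sum_sq a σ) (integrable_const _)] at h
  simp at h
  linarith

lemma IsUniformSphere.integral_log_partitionFunction_le (hP : IsUniformSphere n (√n) P)
    (hm : 0 < m)
    (hint : Integrable (fun z => log (partitionFunction √m P fun i => 0 + √(1 + m) * z i))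
      (stdGaussian n)) :
    ∫ z, log (partitionFunction √m P fun i => 0 + √(1 + m) * z i) ∂(stdGaussian n) ≤
      n * m - n / 2 * log (1 + m) := by
  have hsq : Integrable (fun z : Fin n → ℝ => ∑ i, z i ^ 2) (stdGaussian n) := by
    simpa using integrable_sum_sq (0 : Fin n → ℝ) 1
  have hsq' : ∫ z : Fin n → ℝ, ∑ i, z i ^ 2 ∂(stdGaussian n) = n := by
    simpa using integral_sum_sq (0 : Fin n → ℝ) 1
  have h1 := (hint.sub (integrable_const (m * n / 2))).add
    (integrable_const (n / 2 * log (1 + m)))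
  have h := integral_nonpos_of_lintegral_exp_le_one (h1.sub (hsq.const_mul (m / 2)))
    (hP.lintegral_gaussian_partitionFunction hm).le
  rw [integral_sub' h1 (hsq.const_mul _), integral_add' (hint.sub (integrable_const _))
    (integrable_const _), integral_sub' hint (integrable_const _), integral_const_mul (m / 2), hsq'] at h
  simp only [integral_const, probReal_univ, smul_eq_mul, one_mul] at h
  linarith

lemma IsUniformSphere.exists_le_integral_log_partitionFunction (hP : IsUniformSphere n (√n) P)
    (hm : 0 < m)
    (hint : ∀ X : Fin n → ℝ, ∑ i, X i ^ 2 = n →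
      Integrable (fun z => log (partitionFunction √m P fun i => √m * X i + 1 * z i))
        (stdGaussian n)) :
    ∃ X : Fin n → ℝ, ∑ i, X i ^ 2 = n ∧ n * m - n / 2 * log (1 + m) ≤
      ∫ z, log (partitionFunction √m P fun i => √m * X i + 1 * z i) ∂(stdGaussian n) := by
  obtain ⟨X, hX, hle⟩ := hP.exists_lintegral_shifted_le_one hm
  refine ⟨X, hX, ?_⟩
  have hint' := hint X hX
  have hsq : Integrable (fun z : Fin n → ℝ => ∑ i, (√m * X i + z i) ^ 2) (stdGaussian n) := by
    simpa using integrable_sum_sq (fun i => √m * X i) 1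
  have hsq' : ∫ z : Fin n → ℝ, ∑ i, (√m * X i + z i) ^ 2 ∂(stdGaussian n) = n * (1 + m) := by
    have := integral_sum_sq (fun i => √m * X i) 1
    simp only [one_mul, mul_pow, ← Finset.mul_sum, hX, Real.sq_sqrt hm.le] at this
    rw [this]
    ring
  simp only [one_mul] at hint' ⊢
  have h1 := (hsq.const_mul (m / (2 * (1 + m)))).sub (integrable_const (n / 2 * log (1 + m)))
  have h := integral_nonpos_of_lintegral_exp_le_one
    ((h1.sub hint').add (integrable_const (m * n / 2))) hle
  rw [integral_add' (h1.sub hint') (integrable_const _), integral_sub' h1 hint',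
    integral_sub' (hsq.const_mul _) (integrable_const _), integral_const_mul, hsq'] at h
  have h2 : m / (2 * (1 + m)) * (n * (1 + m)) = m * n / 2 := by field_simp
  rw [h2] at h
  simp at h
  linarith

lemma IsUniformSphere.abs_sphericalFreeEntropy_sub_le (hP : IsUniformSphere n (√n) P)
    (hm : 0 < m) (hn : 1 ≤ n) :
    |sphericalFreeEntropy m n P - (m / 2 - log (1 + m) / 2)| ≤
      √m * ((1 + m) * (8 + 2 * gaussianSqFluctuation) + 1) / √n := by
  have := hP.1
  have hn' : (0 : ℝ) < n := by exact_mod_cast hn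
  have h1m : 0 < 1 + m := by linarith
  have hK := gaussianSqFluctuation_nonneg
  set K := gaussianSqFluctuation
  set D := √m * √n * (((1 + m) * (8 + 2 * K) + 1) / 2) with hD
  set L : (Fin n → ℝ) → ℝ := fun y => log (partitionFunction √m P y)
  let y₀ : Fin n → ℝ := fun _ => √(1 + m)
  have hy₀ : ∑ i, y₀ i ^ 2 = n * (1 + m) := by
    simp only [y₀, Real.sq_sqrt h1m.le]
    simp
    ring
  have hq := hP.integrable_log_partitionFunction (by positivity) (Real.sqrt_nonneg m) 0
    √(1 + m) (y₀ := y₀) (by simp [hy₀, Real.sq_sqrt h1m.le])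
    (by simp [Real.sq_sqrt h1m.le]; positivity)
  simp only [Pi.zero_apply, Real.sq_sqrt h1m.le] at hq
  have hX : ∀ X : Fin n → ℝ, ∑ i, X i ^ 2 = n →
      Integrable (fun z => L fun i => √m * X i + 1 * z i) (stdGaussian n) ∧
      |∫ z, L (fun i => √m * X i + 1 * z i) ∂(stdGaussian n) - L y₀| ≤ D := fun X hX => by
    have hs : ∑ i, (√m * X i) ^ 2 + n * (1 : ℝ) ^ 2 = n * (1 + m) := by
      simp_rw [mul_pow, ← Finset.mul_sum, hX, Real.sq_sqrt hm.le]; ring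
    have h := hP.integrable_log_partitionFunction (by positivity) (Real.sqrt_nonneg m)
      (fun i => √m * X i) 1 (y₀ := y₀) (hy₀.trans hs.symm) (by rw [hs]; positivity)
    refine ⟨h.1, h.2.trans ?_⟩
    rw [hD]
    gcongr
    linarith
  have hupper := hP.integral_log_partitionFunction_le hm hq.1
  obtain ⟨X₁, hX₁, hlower⟩ :=
    hP.exists_le_integral_log_partitionFunction hm fun X hX' => (hX X hX').1
  have hLy₀ : |L y₀ - (n * m - n / 2 * log (1 + m))| ≤ D := by
    have h1 := abs_le.1 hq.2
    have h2 := abs_le.1 (hX X₁ hX₁).2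
    rw [abs_le]
    constructor <;> linarith
  set G : (Fin n → ℝ) → ℝ := fun X => ∫ Z, log (∫ x, exp (√m * (∑ i, x i * (√m * X i + Z i)) -
    m / 2 * ∑ i, (x i) ^ 2) ∂P) ∂(stdGaussian n)
  have hG : ∀ᵐ X ∂P, ‖G X - (n * (m / 2 - log (1 + m) / 2))‖ ≤ 2 * D := by
    filter_upwards [hP.2.1] with X hXn
    rw [Real.sq_sqrt hn'.le] at hXn
    have h1 : ∀ Z : Fin n → ℝ, log (∫ x, exp (√m * (∑ i, x i * (√m * X i + Z i)) -
        m / 2 * ∑ i, (x i) ^ 2) ∂P) = L (fun i => √m * X i + 1 * Z i) - m / 2 * n := fun Z => by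
      have h2 : ∫ x, exp (√m * (∑ i, x i * (√m * X i + Z i)) - m / 2 * ∑ i, (x i) ^ 2) ∂P =
          partitionFunction √m P (fun i => √m * X i + 1 * Z i) * exp (-(m / 2 * n)) := by
        rw [partitionFunction, ← integral_mul_const]
        refine integral_congr_ae ?_
        filter_upwards [hP.2.1] with x hx
        rw [hx, Real.sq_sqrt hn'.le, ← exp_add]
        simp only [one_mul, sub_eq_add_neg]
      rw [h2, log_mul (hP.partitionFunction_pos (by positivity) (Real.sqrt_nonneg m) _).ne'
        (exp_pos _).ne', log_exp, sub_eq_add_neg]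
    simp only [G, h1]
    rw [integral_sub (hX X hXn).1 (integrable_const _)]
    simp only [integral_const, probReal_univ, smul_eq_mul, one_mul, norm_eq_abs]
    have h2 := abs_le.1 (hX X hXn).2
    have h3 := abs_le.1 hLy₀
    simp only [one_mul] at h2
    rw [abs_le]
    constructor <;> linarith
  have hGm : StronglyMeasurable G := by
    refine StronglyMeasurable.integral_prod_right (f := fun X Z : Fin n → ℝ =>
      log (∫ x, exp (√m * (∑ i, x i * (√m * X i + Z i)) - m / 2 * ∑ i, (x i) ^ 2) ∂P)) ?_
    refine Measurable.stronglyMeasurable (Measurable.log (StronglyMeasurable.measurable ?_))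
    refine StronglyMeasurable.integral_prod_right
      (f := fun (p : (Fin n → ℝ) × (Fin n → ℝ)) (x : Fin n → ℝ) =>
        exp (√m * (∑ i, x i * (√m * p.1 i + p.2 i)) - m / 2 * ∑ i, (x i) ^ 2)) ?_
    exact Measurable.stronglyMeasurable (by simp only [Function.uncurry_def]; fun_prop)
  have hGi : Integrable (fun X => G X - (n * (m / 2 - log (1 + m) / 2))) P :=
    Integrable.of_bound (hGm.measurable.sub_const _).aestronglyMeasurable _ hG
  have hGi' : Integrable G P :=
    (hGi.add (integrable_const (n * (m / 2 - log (1 + m) / 2)))).congr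
      (ae_of_all _ fun X => by simp)
  have hfin := norm_integral_le_of_norm_le_const hG
  rw [integral_sub hGi' (integrable_const _)] at hfin
  simp only [integral_const, probReal_univ, smul_eq_mul, one_mul, mul_one, norm_eq_abs] at hfin
  have hentropy : sphericalFreeEntropy m n P - (m / 2 - log (1 + m) / 2) =
      (∫ X, G X ∂P - n * (m / 2 - log (1 + m) / 2)) / n := by
    rw [show sphericalFreeEntropy m n P = 1 / n * ∫ X, G X ∂P from rfl]
    field_simp
  rw [hentropy, abs_div, abs_of_pos hn', div_le_iff₀ hn']
  refine hfin.trans (le_of_eq ?_)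
  have hsn : √(n : ℝ) ≠ 0 := by positivity
  rw [hD]
  field_simp
  rw [Real.sq_sqrt hn'.le]

end Channel

/-- For `m > 0` and `X` uniform on the sphere of radius `√n` in `ℝⁿ`
observed through the AWGN channel `Ỹ = √m X + Z̃`, the average free entropy converges
to `m/2 − ln(1+m)/2`; equivalently the mutual information per dimension
`I(X;Ỹ)/n = m/2 − f̃ₙ` converges to `ln(1+m)/2`. -/
theorem spherical_channel_free_entropy_limit
    (m : ℝ) (hm : 0 < m)
    (P : (n : ℕ) → Measure (Fin n → ℝ))
    (hP : ∀ n, 1 ≤ n → IsUniformSphere n (Real.sqrt n) (P n)) :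
    Tendsto (fun n => sphericalFreeEntropy m n (P n)) atTop
        (nhds (m / 2 - Real.log (1 + m) / 2)) ∧
    Tendsto (fun n => m / 2 - sphericalFreeEntropy m n (P n)) atTop
        (nhds (Real.log (1 + m) / 2)) := by
  have hlim : Tendsto (fun n => sphericalFreeEntropy m n (P n)) atTop
      (nhds (m / 2 - Real.log (1 + m) / 2)) := by
    rw [tendsto_iff_norm_sub_tendsto_zero]
    refine squeeze_zero' (Eventually.of_forall fun _ => norm_nonneg _)
      ((eventually_ge_atTop 1).mono fun n hn =>
        (hP n hn).abs_sphericalFreeEntropy_sub_le hm hn) ?_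
    exact tendsto_const_nhds.div_atTop
      (tendsto_sqrt_atTop.comp tendsto_natCast_atTop_atTop)
  refine ⟨hlim, ?_⟩
  simpa using hlim.const_sub (m / 2)

end
end

section
/- Let m > 0 and n ≥ 1. Let X̃ ∈ ℝⁿ have i.i.d. standard Gaussian entries and let f̃ₙ be the average free entropy of the channel Ỹ = √m · X + Z̃ with X = √n · X̃/‖X̃‖ uniform on the sphere of radius √n and Z̃ an independent standard Gaussian vector, i.e. f̃ₙ = (1/n) E ln ∫ exp( √m · ⟨x, Ỹ⟩ − (m/2)‖x‖² ) dP_x(x) with P_x the uniform probability measure on the sphere of radius √n in ℝⁿ. Then | m/2 − ln(1+m)/2 − f̃ₙ | ≤ (m/√n) · √( E[ (‖X̃‖ − √n)² ] ). -/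
open MeasureTheory Real Filter

noncomputable section

/-- Euclidean norm of a vector in `Fin n → ℝ`. -/
def enorm' {n : ℕ} (x : Fin n → ℝ) : ℝ := Real.sqrt (∑ i, (x i) ^ 2)

/-- The average free entropy `f̃ₙ` of the channel `Ỹ = √m X + Z̃`, where
`X = √n X̃/‖X̃‖` with `X̃` a standard Gaussian vector, `Z̃` an independent standard
Gaussian vector, and where the integral inside the logarithm is with respect to the
uniform measure `P` on the sphere of radius `√n`:
`f̃ₙ = (1/n) E ln ∫ exp(√m ⟨x,Ỹ⟩ − (m/2)‖x‖²) dP(x)`. -/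
def gaussSphereFreeEntropy (m : ℝ) (n : ℕ) (P : Measure (Fin n → ℝ)) : ℝ :=
  (1 / (n : ℝ)) *
    ∫ Xt, (∫ Z,
        Real.log (∫ x,
          Real.exp (Real.sqrt m *
              (∑ i, x i * (Real.sqrt m * (Real.sqrt n * Xt i / enorm' Xt) + Z i))
            - m / 2 * ∑ i, (x i) ^ 2) ∂P)
      ∂(stdGaussian n)) ∂(stdGaussian n)

lemma lintegral_pi_prod_ofReal {n : ℕ} {μ : Fin n → Measure ℝ} [∀ i, SigmaFinite (μ i)]
    {f : Fin n → ℝ → ℝ} (hf : ∀ i, Integrable (f i) (μ i)) (hf0 : ∀ i x, 0 ≤ f i x) :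
    ∫⁻ x : Fin n → ℝ, ENNReal.ofReal (∏ i, f i (x i)) ∂(Measure.pi μ)
      = ∏ i, ∫⁻ x, ENNReal.ofReal (f i x) ∂(μ i) := by
  rw [← ofReal_integral_eq_lintegral_ofReal (Integrable.fintype_prod hf)
    (ae_of_all _ fun x => Finset.prod_nonneg fun i _ => hf0 i _),
    integral_fintype_prod_eq_prod,
    ENNReal.ofReal_prod_of_nonneg fun i _ => integral_nonneg (hf0 i)]
  exact Finset.prod_congr rfl fun i _ =>
    ofReal_integral_eq_lintegral_ofReal (hf i) (ae_of_all _ (hf0 i))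

lemma setLIntegral_exp_gaussianReal (u : ℝ) {s : Set ℝ} (hs : MeasurableSet s) :
    ∫⁻ y in s, ENNReal.ofReal (exp (u * y - u ^ 2 / 2)) ∂(ProbabilityTheory.gaussianReal 0 1)
      = ProbabilityTheory.gaussianReal u 1 s := by
  rw [ProbabilityTheory.gaussianReal_apply u one_ne_zero,
    ProbabilityTheory.gaussianReal_of_var_ne_zero 0 one_ne_zero,
    setLIntegral_withDensity_eq_setLIntegral_mul _ (ProbabilityTheory.measurable_gaussianPDF 0 1)
      (by fun_prop) hs]
  refine lintegral_congr fun y => ?_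
  rw [Pi.mul_apply, ProbabilityTheory.gaussianPDF, ProbabilityTheory.gaussianPDF,
    ← ENNReal.ofReal_mul (ProbabilityTheory.gaussianPDFReal_nonneg _ _ _),
    ProbabilityTheory.gaussianPDFReal, ProbabilityTheory.gaussianPDFReal, mul_assoc, ← exp_add]
  congr 3
  push_cast
  ring

lemma integrable_exp_sub_gaussianReal (u c : ℝ) :
    Integrable (fun y => exp (u * y - c)) (ProbabilityTheory.gaussianReal 0 1) := by
  simp_rw [sub_eq_add_neg, exp_add]
  exact (ProbabilityTheory.integrable_exp_mul_gaussianReal u).mul_const _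

instance instIsProbabilityMeasureStdGaussian (n : ℕ) : IsProbabilityMeasure (stdGaussian n) := by
  unfold stdGaussian
  infer_instance

/-- Cameron-Martin formula for the standard Gaussian measure on `ℝⁿ`. -/
lemma lintegral_add_stdGaussian {n : ℕ} (u : Fin n → ℝ) {h : (Fin n → ℝ) → ENNReal}
    (hh : Measurable h) :
    ∫⁻ z, h (u + z) ∂(stdGaussian n)
      = ∫⁻ y, ENNReal.ofReal (exp (∑ i, u i * y i - (∑ i, u i ^ 2) / 2)) * h y
          ∂(stdGaussian n) := by
  have hmap : (stdGaussian n).map (fun z => u + z)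
      = Measure.pi fun i => ProbabilityTheory.gaussianReal (u i) 1 := by
    have := Measure.pi_map_pi (μ := fun _ : Fin n => ProbabilityTheory.gaussianReal 0 1)
      (f := fun i x => u i + x)
      (hμ := fun i => by
        rw [ProbabilityTheory.gaussianReal_map_const_add]; infer_instance)
      (fun i => by fun_prop)
    simp only [ProbabilityTheory.gaussianReal_map_const_add, zero_add] at this
    exact this
  have hdens : Measure.pi (fun i => ProbabilityTheory.gaussianReal (u i) 1)
      = (stdGaussian n).withDensity
        (fun y => ENNReal.ofReal (exp (∑ i, u i * y i - (∑ i, u i ^ 2) / 2))) := by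
    refine Measure.pi_eq fun s hs => ?_
    rw [withDensity_apply _ (MeasurableSet.univ_pi hs), stdGaussian, Measure.restrict_pi_pi]
    have := lintegral_pi_prod_ofReal
      (μ := fun i => (ProbabilityTheory.gaussianReal 0 1).restrict (s i))
      (f := fun i y => exp (u i * y - u i ^ 2 / 2))
      (fun i => (integrable_exp_sub_gaussianReal _ _).restrict) (fun i x => (exp_pos _).le)
    simp only [setLIntegral_exp_gaussianReal _ (hs _)] at this
    rw [← this]
    refine lintegral_congr fun y => ?_
    rw [← exp_sum, Finset.sum_sub_distrib, Finset.sum_div]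
  rw [← lintegral_map hh (by fun_prop), hmap, hdens,
    lintegral_withDensity_eq_lintegral_mul _ (by fun_prop) hh]
  rfl

lemma lintegral_exp_stdGaussian {n : ℕ} (u : Fin n → ℝ) :
    ∫⁻ y, ENNReal.ofReal (exp (∑ i, u i * y i - (∑ i, u i ^ 2) / 2)) ∂(stdGaussian n) = 1 := by
  simpa using (lintegral_add_stdGaussian u (h := 1) measurable_const).symm

lemma exp_mul_sub_sq_mul_gaussianPDFReal {m : ℝ} (hm : 0 < m) (y x : ℝ) :
    ProbabilityTheory.gaussianPDFReal 0 1 x * exp (√m * (x * y) - m / 2 * x ^ 2)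
      = exp (-(log (1 + m) / 2) + m / (2 * (1 + m)) * y ^ 2) *
        ProbabilityTheory.gaussianPDFReal (√m * y / (1 + m)) (Real.toNNReal (1 / (1 + m))) x := by
  have h1 : 0 < 1 + m := by linarith
  have hsq : exp (-(log (1 + m) / 2)) = (√(1 + m))⁻¹ := by
    rw [exp_neg, ← log_sqrt h1.le, exp_log (sqrt_pos.2 h1)]
  rw [ProbabilityTheory.gaussianPDFReal, ProbabilityTheory.gaussianPDFReal, exp_add, hsq,
    Real.coe_toNNReal _ (by positivity), mul_one_div, sqrt_div (by positivity)]
  have hs : √(1 + m) ≠ 0 := (sqrt_pos.2 h1).ne'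
  have hm2 : √m ^ 2 = m := sq_sqrt hm.le
  have hexp : exp (-(x - 0) ^ 2 / (2 * 1)) * exp (√m * (x * y) - m / 2 * x ^ 2)
      = exp (m / (2 * (1 + m)) * y ^ 2) *
        exp (-(x - √m * y / (1 + m)) ^ 2 / (2 * (1 / (1 + m)))) := by
    rw [← exp_add, ← exp_add]
    congr 1
    field_simp
    ring_nf
    rw [hm2]
    ring
  push_cast
  rw [mul_assoc, hexp, mul_one]
  field_simp

lemma integrable_exp_mul_sub_sq_gaussianReal {m : ℝ} (hm : 0 < m) (y : ℝ) :
    Integrable (fun x => exp (√m * (x * y) - m / 2 * x ^ 2))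
      (ProbabilityTheory.gaussianReal 0 1) := by
  refine ((integrable_const (exp (y ^ 2 / 2))).mono' (by fun_prop) (ae_of_all _ fun x => ?_))
  rw [norm_of_nonneg (exp_pos _).le, exp_le_exp]
  nlinarith [sq_nonneg (√m * x - y), sq_sqrt hm.le]

lemma lintegral_exp_mul_sub_sq_gaussianReal {m : ℝ} (hm : 0 < m) (y : ℝ) :
    ∫⁻ x, ENNReal.ofReal (exp (√m * (x * y) - m / 2 * x ^ 2))
        ∂(ProbabilityTheory.gaussianReal 0 1)
      = ENNReal.ofReal (exp (-(log (1 + m) / 2) + m / (2 * (1 + m)) * y ^ 2)) := by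
  rw [← ofReal_integral_eq_lintegral_ofReal (integrable_exp_mul_sub_sq_gaussianReal hm y)
    (ae_of_all _ fun x => (exp_pos _).le),
    ProbabilityTheory.integral_gaussianReal_eq_integral_smul one_ne_zero]
  simp_rw [smul_eq_mul, exp_mul_sub_sq_mul_gaussianPDFReal hm]
  rw [integral_const_mul, ProbabilityTheory.integral_gaussianPDFReal_eq_one, mul_one]
  rw [Ne, Real.toNNReal_eq_zero, not_le]
  positivity

/-- The logarithm of the output likelihood ratio of the Gaussian channel with Gaussian input. -/
def gaussLogLik (m : ℝ) {n : ℕ} (y : Fin n → ℝ) : ℝ :=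
  -(n * (log (1 + m) / 2)) + m / (2 * (1 + m)) * ∑ i, y i ^ 2

lemma lintegral_channel_stdGaussian {m : ℝ} (hm : 0 < m) {n : ℕ} (y : Fin n → ℝ) :
    ∫⁻ x, ENNReal.ofReal (exp (√m * (∑ i, x i * y i) - m / 2 * ∑ i, x i ^ 2)) ∂(stdGaussian n)
      = ENNReal.ofReal (exp (gaussLogLik m y)) := by
  have := lintegral_pi_prod_ofReal (μ := fun _ => ProbabilityTheory.gaussianReal 0 1)
    (f := fun i x => exp (√m * (x * y i) - m / 2 * x ^ 2))
    (fun i => integrable_exp_mul_sub_sq_gaussianReal hm _) (fun i x => (exp_pos _).le)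
  simp only [lintegral_exp_mul_sub_sq_gaussianReal hm] at this
  rw [← ENNReal.ofReal_prod_of_nonneg fun i _ => (exp_pos _).le, ← exp_sum,
    Finset.sum_add_distrib, ← Finset.mul_sum] at this
  simp only [Finset.sum_const, Finset.card_univ, Fintype.card_fin, nsmul_eq_mul, mul_neg] at this
  rw [gaussLogLik, stdGaussian, ← this]
  refine lintegral_congr fun x => ?_
  rw [← exp_sum, Finset.sum_sub_distrib, Finset.mul_sum, Finset.mul_sum]

/-- A vector is moved to any other vector of the same Euclidean norm by a Householder matrix. -/
lemma exists_orthogonal_mulVec_eq {n : ℕ} {u v : Fin n → ℝ} (h : ∑ i, u i ^ 2 = ∑ i, v i ^ 2) :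
    ∃ O ∈ Matrix.orthogonalGroup (Fin n) ℝ, O.mulVec u = v := by
  by_cases huv : u = v
  · exact ⟨1, one_mem _, by simp [huv]⟩
  set w := u - v with hw
  have hw0 : w ⬝ᵥ w ≠ 0 := by
    rw [Ne, dotProduct_self_eq_zero]
    exact sub_ne_zero.2 huv
  have hsq : ∀ x : Fin n → ℝ, ∑ i, x i ^ 2 = x ⬝ᵥ x := fun x => by
    simp [dotProduct, sq]
  have huw : 2 * (w ⬝ᵥ u) = w ⬝ᵥ w := by
    rw [hsq, hsq] at h
    simp only [hw, sub_dotProduct, dotProduct_sub]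
    rw [dotProduct_comm v u]
    linarith
  refine ⟨1 - (2 / (w ⬝ᵥ w)) • Matrix.vecMulVec w w, ?_, ?_⟩
  · rw [Matrix.mem_orthogonalGroup_iff, Matrix.transpose_sub, Matrix.transpose_one,
      Matrix.transpose_smul, Matrix.transpose_vecMulVec, sub_mul, mul_sub, mul_sub, one_mul,
      one_mul, mul_one, smul_mul_smul_comm, Matrix.vecMulVec_mul_vecMulVec, Matrix.vecMulVec_smul,
      smul_smul]
    have : 2 / w ⬝ᵥ w * (2 / w ⬝ᵥ w) * w ⬝ᵥ w = 2 / w ⬝ᵥ w + 2 / w ⬝ᵥ w := by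
      field_simp
      norm_num
    rw [this, add_smul]
    abel
  · rw [Matrix.sub_mulVec, Matrix.one_mulVec, Matrix.smul_mulVec, Matrix.vecMulVec_mulVec]
    ext i
    simp only [Pi.sub_apply, Pi.smul_apply, smul_eq_mul, MulOpposite.smul_eq_mul_unop, MulOpposite.unop_op]
    have : 2 / w ⬝ᵥ w * (w i * w ⬝ᵥ u) = w i := by
      field_simp
      linear_combination (w i) * huw
    rw [this]
    simp [hw]

lemma sum_mulVec_mul_mulVec {n : ℕ} {O : Matrix (Fin n) (Fin n) ℝ}
    (hO : O ∈ Matrix.orthogonalGroup (Fin n) ℝ) (x y : Fin n → ℝ) :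
    ∑ i, O.mulVec x i * O.mulVec y i = ∑ i, x i * y i := by
  change O.mulVec x ⬝ᵥ O.mulVec y = x ⬝ᵥ y
  have h := (Matrix.mem_orthogonalGroup_iff' _ _).1 hO
  rw [Matrix.dotProduct_mulVec, Matrix.vecMul_mulVec, h, Matrix.vecMul_one]

lemma sum_mulVec_sq {n : ℕ} {O : Matrix (Fin n) (Fin n) ℝ}
    (hO : O ∈ Matrix.orthogonalGroup (Fin n) ℝ) (x : Fin n → ℝ) :
    ∑ i, O.mulVec x i ^ 2 = ∑ i, x i ^ 2 := by
  simpa only [sq] using sum_mulVec_mul_mulVec hO x x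

lemma measurable_mulVec {n : ℕ} (O : Matrix (Fin n) (Fin n) ℝ) :
    Measurable (fun x : Fin n → ℝ => O.mulVec x) :=
  (Continuous.matrix_mulVec continuous_const continuous_id).measurable

lemma stdGaussian_map_mulVec {n : ℕ} {O : Matrix (Fin n) (Fin n) ℝ}
    (hO : O ∈ Matrix.orthogonalGroup (Fin n) ℝ) :
    (stdGaussian n).map (fun x => O.mulVec x) = stdGaussian n := by
  let f : EuclideanSpace ℝ (Fin n) →ₗᵢ[ℝ] EuclideanSpace ℝ (Fin n) :=
    { toLinearMap := Matrix.toEuclideanLin O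
      norm_map' := fun x => by
        rw [EuclideanSpace.norm_eq, EuclideanSpace.norm_eq]
        simpa using congrArg sqrt (sum_mulVec_sq hO x) }
  have hlp : (stdGaussian n).map (WithLp.toLp 2)
      = ProbabilityTheory.stdGaussian (EuclideanSpace ℝ (Fin n)) :=
    ProbabilityTheory.map_pi_eq_stdGaussian
  have hf := ProbabilityTheory.stdGaussian_map (f.toLinearIsometryEquiv rfl)
  have hback : ∀ μ : Measure (Fin n → ℝ), (μ.map (WithLp.toLp 2)).map
      (WithLp.ofLp (p := 2) (V := Fin n → ℝ)) = μ := fun μ => by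
    rw [Measure.map_map (by fun_prop) (by fun_prop)]
    exact Measure.map_id
  rw [← hback ((stdGaussian n).map _), Measure.map_map (by fun_prop) (measurable_mulVec O)]
  conv_rhs => rw [← hback (stdGaussian n), hlp, ← hf, ← hlp,
    Measure.map_map (LinearIsometryEquiv.continuous _).measurable (by fun_prop)]
  rfl

/-- The output likelihood ratio of the Gaussian channel with input distribution `P`. -/
def channelLik (m : ℝ) {n : ℕ} (P : Measure (Fin n → ℝ)) (y : Fin n → ℝ) : ℝ :=
  ∫ x, exp (√m * (∑ i, x i * y i) - m / 2 * ∑ i, x i ^ 2) ∂P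

/-- The mean log-likelihood ratio when the channel input is `v`. -/
def meanLogLik (m : ℝ) {n : ℕ} (P : Measure (Fin n → ℝ)) (v : Fin n → ℝ) : ℝ :=
  ∫ z, log (channelLik m P (√m • v + z)) ∂(stdGaussian n)

section Moments

variable {n : ℕ}

lemma integrable_eval_stdGaussian (i : Fin n) : Integrable (fun z => z i) (stdGaussian n) :=
  (measurePreserving_eval (fun _ : Fin n => ProbabilityTheory.gaussianReal 0 1)
    i).integrable_comp_of_integrable
    ((ProbabilityTheory.memLp_id_gaussianReal 1).integrable (by simp))

lemma integrable_eval_sq_stdGaussian (i : Fin n) :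
    Integrable (fun z => z i ^ 2) (stdGaussian n) :=
  (measurePreserving_eval (fun _ : Fin n => ProbabilityTheory.gaussianReal 0 1)
    i).integrable_comp_of_integrable
    (g := fun x => x ^ 2) (ProbabilityTheory.memLp_id_gaussianReal 2).integrable_sq

lemma integral_eval_stdGaussian (i : Fin n) : ∫ z, z i ∂(stdGaussian n) = 0 := by
  have h := measurePreserving_eval (fun _ : Fin n => ProbabilityTheory.gaussianReal 0 1) i
  have h2 := integral_map (μ := stdGaussian n) (φ := Function.eval i) (f := fun x : ℝ => x)
    (measurable_pi_apply i).aemeasurable (by fun_prop)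
  rw [stdGaussian, h.map_eq, ProbabilityTheory.integral_id_gaussianReal] at h2
  exact h2.symm

lemma integral_eval_sq_stdGaussian (i : Fin n) : ∫ z, z i ^ 2 ∂(stdGaussian n) = 1 := by
  have h := measurePreserving_eval (fun _ : Fin n => ProbabilityTheory.gaussianReal 0 1) i
  have h2 := integral_map (μ := stdGaussian n) (φ := Function.eval i) (f := fun x : ℝ => x ^ 2)
    (measurable_pi_apply i).aemeasurable (by fun_prop)
  have hv := ProbabilityTheory.variance_of_integral_eq_zero (X := fun x : ℝ => x)
    (μ := ProbabilityTheory.gaussianReal 0 1) (by fun_prop)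
    ProbabilityTheory.integral_id_gaussianReal
  rw [ProbabilityTheory.variance_fun_id_gaussianReal] at hv
  rw [stdGaussian, h.map_eq] at h2
  rw [stdGaussian]
  refine h2.symm.trans (hv.symm.trans (by simp))

lemma integrable_sum_sq_stdGaussian :
    Integrable (fun z => ∑ i, z i ^ 2) (stdGaussian n) :=
  integrable_finsetSum _ fun i _ => integrable_eval_sq_stdGaussian i

lemma integral_sum_sq_stdGaussian : ∫ z, ∑ i, z i ^ 2 ∂(stdGaussian n) = n := by
  rw [integral_finsetSum _ fun i _ => integrable_eval_sq_stdGaussian i]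
  simp [integral_eval_sq_stdGaussian]

lemma integrable_sum_mul_add_stdGaussian (a u : Fin n → ℝ) :
    Integrable (fun z => ∑ i, a i * (u + z) i) (stdGaussian n) :=
  integrable_finsetSum _ fun i _ =>
    ((integrable_const (u i)).add (integrable_eval_stdGaussian i)).const_mul (a i)

lemma integral_sum_mul_add_stdGaussian (a u : Fin n → ℝ) :
    ∫ z, ∑ i, a i * (u + z) i ∂(stdGaussian n) = ∑ i, a i * u i := by
  have hi : ∀ i, Integrable (fun z : Fin n → ℝ => a i * (u + z) i) (stdGaussian n) := fun i =>
    ((integrable_const (u i)).add (integrable_eval_stdGaussian i)).const_mul (a i)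
  rw [integral_finsetSum _ fun i _ => hi i]
  refine Finset.sum_congr rfl fun i _ => ?_
  simp only [Pi.add_apply]
  rw [integral_const_mul, integral_add (integrable_const _) (integrable_eval_stdGaussian i),
    integral_eval_stdGaussian]
  simp

lemma sum_add_sq_eq (u z : Fin n → ℝ) :
    ∑ i, (u + z) i ^ 2 = 2 * (∑ i, u i * (u + z) i) - ∑ i, u i ^ 2 + ∑ i, z i ^ 2 := by
  rw [Finset.mul_sum, ← Finset.sum_sub_distrib, ← Finset.sum_add_distrib]
  refine Finset.sum_congr rfl fun i _ => ?_
  simp only [Pi.add_apply]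
  ring

lemma integrable_sum_add_sq_stdGaussian (u : Fin n → ℝ) :
    Integrable (fun z => ∑ i, (u + z) i ^ 2) (stdGaussian n) := by
  simp_rw [sum_add_sq_eq]
  exact (((integrable_sum_mul_add_stdGaussian u u).const_mul 2).sub (integrable_const _)).add
    integrable_sum_sq_stdGaussian

lemma integral_sum_add_sq_stdGaussian (u : Fin n → ℝ) :
    ∫ z, ∑ i, (u + z) i ^ 2 ∂(stdGaussian n) = ∑ i, u i ^ 2 + n := by
  simp_rw [sum_add_sq_eq]
  have h1 := (integrable_sum_mul_add_stdGaussian u u).const_mul 2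
  have h2 : Integrable (fun z => 2 * (∑ i, u i * (u + z) i) - ∑ i, u i ^ 2) (stdGaussian n) :=
    h1.sub (integrable_const _)
  rw [integral_add h2 integrable_sum_sq_stdGaussian, integral_sub h1 (integrable_const _), integral_const_mul, integral_sum_mul_add_stdGaussian,
    integral_sum_sq_stdGaussian]
  simp only [integral_const, probReal_univ, smul_eq_mul, ← sq]
  ring

end Moments

lemma ofReal_integral_le_lintegral_ofReal {α : Type*} [MeasurableSpace α] {μ : Measure α}
    {f : α → ℝ} (hf : Integrable f μ) :
    ENNReal.ofReal (∫ x, f x ∂μ) ≤ ∫⁻ x, ENNReal.ofReal (f x) ∂μ := by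
  calc ENNReal.ofReal (∫ x, f x ∂μ)
      ≤ ENNReal.ofReal (∫ x, max (f x) 0 ∂μ) :=
        ENNReal.ofReal_le_ofReal (integral_mono hf hf.pos_part fun x => le_max_left _ _)
    _ = ∫⁻ x, ENNReal.ofReal (max (f x) 0) ∂μ :=
        ofReal_integral_eq_lintegral_ofReal hf.pos_part (ae_of_all _ fun x => le_max_right _ _)
    _ = ∫⁻ x, ENNReal.ofReal (f x) ∂μ := by simp

/-- Change of measure combined with `1 + t ≤ exp t`. -/
lemma ofReal_integral_add_one_le {n : ℕ} (u : Fin n → ℝ) {g : (Fin n → ℝ) → ℝ}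
    (hg : Measurable g) (hgi : Integrable (fun z => g (u + z)) (stdGaussian n)) :
    ENNReal.ofReal (∫ z, g (u + z) ∂(stdGaussian n) + 1)
      ≤ ∫⁻ y, ENNReal.ofReal (exp (∑ i, u i * y i - (∑ i, u i ^ 2) / 2)) *
          ENNReal.ofReal (exp (g y)) ∂(stdGaussian n) := by
  have h1 : ∫ z, g (u + z) ∂(stdGaussian n) + 1 = ∫ z, (g (u + z) + 1) ∂(stdGaussian n) := by
    rw [integral_add hgi (integrable_const _)]
    simp
  rw [h1, ← lintegral_add_stdGaussian u (h := fun y => ENNReal.ofReal (exp (g y))) (by fun_prop)]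
  exact (ofReal_integral_le_lintegral_ofReal (hgi.add (integrable_const 1))).trans
    (lintegral_mono fun z => ENNReal.ofReal_le_ofReal (add_one_le_exp _))

lemma measurable_gaussLogLik (m : ℝ) (n : ℕ) :
    Measurable (fun y : Fin n → ℝ => gaussLogLik m y) := by
  unfold gaussLogLik
  fun_prop

lemma integrable_gaussLogLik_add (m : ℝ) {n : ℕ} (u : Fin n → ℝ) :
    Integrable (fun z => gaussLogLik m (u + z)) (stdGaussian n) :=
  (integrable_const _).add ((integrable_sum_add_sq_stdGaussian u).const_mul _)

lemma integral_gaussLogLik_add {m : ℝ} (hm : 0 < m) {n : ℕ} {v : Fin n → ℝ}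
    (hv : ∑ i, v i ^ 2 = n) :
    ∫ z, gaussLogLik m (√m • v + z) ∂(stdGaussian n) = n * (m / 2 - log (1 + m) / 2) := by
  unfold gaussLogLik
  rw [integral_add (integrable_const _) ((integrable_sum_add_sq_stdGaussian _).const_mul _),
    integral_const_mul, integral_sum_add_sq_stdGaussian]
  simp only [integral_const, probReal_univ, smul_eq_mul, Pi.smul_apply, mul_pow, sq_sqrt hm.le,
    ← Finset.mul_sum, hv]
  field_simp
  ring

section Sphere

variable {m : ℝ} {n : ℕ} {P : Measure (Fin n → ℝ)}

lemma IsUniformSphere.ae_sum_sq (hP : IsUniformSphere n (√n) P) :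
    ∀ᵐ x ∂P, ∑ i, x i ^ 2 = (n : ℝ) := by
  simpa using hP.2.1

lemma abs_sqrt_mul_sum_le (hm : 0 < m) (x y : Fin n → ℝ) :
    |√m * ∑ i, x i * y i| ≤ m / 2 * ∑ i, x i ^ 2 + (∑ i, y i ^ 2) / 2 := by
  have h : ∀ c : ℝ, c ^ 2 = 1 →
      c * (√m * ∑ i, x i * y i) ≤ m / 2 * ∑ i, x i ^ 2 + (∑ i, y i ^ 2) / 2 := fun c hc => by
    rw [Finset.mul_sum, Finset.mul_sum, Finset.mul_sum, Finset.sum_div, ← Finset.sum_add_distrib]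
    refine Finset.sum_le_sum fun i _ => ?_
    have h1 : (√m * x i - c * y i) ^ 2
        = m * x i ^ 2 - 2 * (c * (√m * (x i * y i))) + y i ^ 2 := by
      have := sq_sqrt hm.le
      linear_combination (x i ^ 2) * this + y i ^ 2 * hc
    linarith [sq_nonneg (√m * x i - c * y i)]
  rw [abs_le]
  constructor
  · linarith [h (-1) (by norm_num)]
  · linarith [h 1 (by norm_num)]

lemma exponent_mem_Icc (hm : 0 < m) {x : Fin n → ℝ} (hx : ∑ i, x i ^ 2 = n) (y : Fin n → ℝ) :
    √m * (∑ i, x i * y i) - m / 2 * ∑ i, x i ^ 2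
      ∈ Set.Icc (-(m * n + (∑ i, y i ^ 2) / 2)) (m * n + (∑ i, y i ^ 2) / 2) := by
  have h := abs_le.1 (abs_sqrt_mul_sum_le hm x y)
  rw [hx] at h ⊢
  have : 0 ≤ m * n := by positivity
  constructor <;> linarith [h.1, h.2]

lemma integrable_channel (hm : 0 < m) (hP : IsUniformSphere n (√n) P) (y : Fin n → ℝ) :
    Integrable (fun x => exp (√m * (∑ i, x i * y i) - m / 2 * ∑ i, x i ^ 2)) P := by
  have := hP.1
  refine (integrable_const (exp (m * n + (∑ i, y i ^ 2) / 2))).mono' (by fun_prop) ?_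
  filter_upwards [hP.ae_sum_sq] with x hx
  rw [norm_of_nonneg (exp_pos _).le, exp_le_exp]
  exact (exponent_mem_Icc hm hx y).2

lemma channelLik_mem_Icc (hm : 0 < m) (hP : IsUniformSphere n (√n) P) (y : Fin n → ℝ) :
    channelLik m P y ∈ Set.Icc (exp (-(m * n + (∑ i, y i ^ 2) / 2)))
      (exp (m * n + (∑ i, y i ^ 2) / 2)) := by
  have := hP.1
  have hi := integrable_channel hm hP y
  have hc : ∀ c : ℝ, ∫ _, c ∂P = c := fun c => by simp
  constructor
  · rw [← hc (exp (-(m * n + (∑ i, y i ^ 2) / 2)))]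
    refine integral_mono_ae (integrable_const _) hi ?_
    filter_upwards [hP.ae_sum_sq] with x hx using exp_le_exp.2 (exponent_mem_Icc hm hx y).1
  · rw [← hc (exp (m * n + (∑ i, y i ^ 2) / 2))]
    refine integral_mono_ae hi (integrable_const _) ?_
    filter_upwards [hP.ae_sum_sq] with x hx using exp_le_exp.2 (exponent_mem_Icc hm hx y).2

lemma channelLik_pos (hm : 0 < m) (hP : IsUniformSphere n (√n) P) (y : Fin n → ℝ) :
    0 < channelLik m P y :=
  (exp_pos _).trans_le (channelLik_mem_Icc hm hP y).1

lemma abs_log_channelLik_le (hm : 0 < m) (hP : IsUniformSphere n (√n) P) (y : Fin n → ℝ) :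
    |log (channelLik m P y)| ≤ m * n + (∑ i, y i ^ 2) / 2 := by
  have h := channelLik_mem_Icc hm hP y
  have h0 := channelLik_pos hm hP y
  exact abs_le.2 ⟨(le_log_iff_exp_le h0).2 h.1, (log_le_iff_le_exp h0).2 h.2⟩

lemma ofReal_channelLik (hm : 0 < m) (hP : IsUniformSphere n (√n) P) (y : Fin n → ℝ) :
    ENNReal.ofReal (channelLik m P y)
      = ∫⁻ x, ENNReal.ofReal (exp (√m * (∑ i, x i * y i) - m / 2 * ∑ i, x i ^ 2)) ∂P :=
  ofReal_integral_eq_lintegral_ofReal (integrable_channel hm hP y)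
    (ae_of_all _ fun _ => (exp_pos _).le)

lemma measurable_channelLik (m : ℝ) (P : Measure (Fin n → ℝ)) [SFinite P] :
    Measurable (channelLik m P) := by
  have : StronglyMeasurable (fun p : (Fin n → ℝ) × (Fin n → ℝ) =>
      exp (√m * (∑ i, p.2 i * p.1 i) - m / 2 * ∑ i, p.2 i ^ 2)) :=
    Measurable.stronglyMeasurable (by fun_prop)
  exact this.integral_prod_right.measurable

lemma measurable_log_channelLik (hP : IsUniformSphere n (√n) P) :
    Measurable (fun y => log (channelLik m P y)) := by
  have := hP.1
  exact (measurable_channelLik m P).log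

lemma integrable_log_channelLik_add (hm : 0 < m) (hP : IsUniformSphere n (√n) P)
    (u : Fin n → ℝ) :
    Integrable (fun z => log (channelLik m P (u + z))) (stdGaussian n) := by
  refine ((integrable_const (m * n)).add ((integrable_sum_add_sq_stdGaussian u).div_const 2)).mono'
    ((measurable_log_channelLik hP).comp (by fun_prop)).aestronglyMeasurable
    (ae_of_all _ fun z => ?_)
  exact abs_log_channelLik_le hm hP (u + z)

lemma channelLik_mulVec (hP : IsUniformSphere n (√n) P) {O : Matrix (Fin n) (Fin n) ℝ}
    (hO : O ∈ Matrix.orthogonalGroup (Fin n) ℝ) (y : Fin n → ℝ) :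
    channelLik m P (O.mulVec y) = channelLik m P y := by
  unfold channelLik
  conv_lhs => rw [← hP.2.2 O hO]
  rw [integral_map (measurable_mulVec O).aemeasurable (by fun_prop)]
  simp_rw [sum_mulVec_mul_mulVec hO, sum_mulVec_sq hO]

lemma meanLogLik_mulVec (hP : IsUniformSphere n (√n) P) {O : Matrix (Fin n) (Fin n) ℝ}
    (hO : O ∈ Matrix.orthogonalGroup (Fin n) ℝ) (v : Fin n → ℝ) :
    meanLogLik m P (O.mulVec v) = meanLogLik m P v := by
  unfold meanLogLik
  conv_lhs => rw [← stdGaussian_map_mulVec hO]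
  have hmeas : Measurable fun z => log (channelLik m P (√m • O.mulVec v + z)) :=
    (measurable_log_channelLik hP).comp (by fun_prop)
  rw [integral_map (measurable_mulVec O).aemeasurable hmeas.aestronglyMeasurable]
  simp_rw [← Matrix.mulVec_smul, ← Matrix.mulVec_add, channelLik_mulVec hP hO]

lemma meanLogLik_eq_of_sum_sq_eq (hP : IsUniformSphere n (√n) P) {u v : Fin n → ℝ}
    (h : ∑ i, u i ^ 2 = ∑ i, v i ^ 2) : meanLogLik m P u = meanLogLik m P v := by
  obtain ⟨O, hO, rfl⟩ := exists_orthogonal_mulVec_eq h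
  exact (meanLogLik_mulVec hP hO u).symm

lemma cameronMartin_exponent_smul (hm : 0 < m) (v y : Fin n → ℝ) :
    ∑ i, (√m • v) i * y i - (∑ i, (√m • v) i ^ 2) / 2
      = √m * (∑ i, v i * y i) - m / 2 * ∑ i, v i ^ 2 := by
  simp only [Pi.smul_apply, smul_eq_mul, mul_pow, sq_sqrt hm.le, mul_assoc, ← Finset.mul_sum]
  ring

/-- Gaussian inputs minimise the mean log-likelihood ratio for a given second moment. -/
lemma gauss_le_meanLogLik (hm : 0 < m) (hP : IsUniformSphere n (√n) P) {v : Fin n → ℝ}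
    (hv : ∑ i, v i ^ 2 = n) :
    n * (m / 2 - log (1 + m) / 2) ≤ meanLogLik m P v := by
  have := hP.1
  set K : (Fin n → ℝ) → (Fin n → ℝ) → ENNReal := fun x y =>
    ENNReal.ofReal (exp (√m * (∑ i, x i * y i) - m / 2 * ∑ i, x i ^ 2)) with hK
  set R : (Fin n → ℝ) → ENNReal := fun y =>
    ENNReal.ofReal (exp (gaussLogLik m y - log (channelLik m P y))) with hR
  have hRm : Measurable R :=
    ((measurable_gaussLogLik m n).sub (measurable_log_channelLik hP)).exp.ennreal_ofReal
  have hpt : ∀ᵐ x ∂P, ENNReal.ofReal (n * (m / 2 - log (1 + m) / 2) - meanLogLik m P v + 1)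
      ≤ ∫⁻ y, K x y * R y ∂(stdGaussian n) := by
    filter_upwards [hP.ae_sum_sq] with x hx
    have h := ofReal_integral_add_one_le (√m • x)
      (g := fun y => gaussLogLik m y - log (channelLik m P y))
      ((measurable_gaussLogLik m n).sub (measurable_log_channelLik hP))
      ((integrable_gaussLogLik_add m _).sub (integrable_log_channelLik_add hm hP _))
    rw [integral_sub (integrable_gaussLogLik_add m _) (integrable_log_channelLik_add hm hP _),
      integral_gaussLogLik_add hm hx] at h
    simp_rw [cameronMartin_exponent_smul hm] at h
    rw [meanLogLik_eq_of_sum_sq_eq hP (hv.trans hx.symm)]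
    exact h
  have hone : ∫⁻ x, ∫⁻ y, K x y * R y ∂(stdGaussian n) ∂P = 1 := by
    rw [lintegral_lintegral_swap (by fun_prop)]
    have hin : ∀ y, ∫⁻ x, K x y * R y ∂P = ∫⁻ x, K x y ∂(stdGaussian n) := fun y => by
      rw [lintegral_mul_const _ (by fun_prop), hK, ← ofReal_channelLik hm hP, hR,
        ← ENNReal.ofReal_mul (channelLik_pos hm hP y).le, lintegral_channel_stdGaussian hm,
        exp_sub, exp_log (channelLik_pos hm hP y), mul_div_cancel₀ _ (channelLik_pos hm hP y).ne']
    simp_rw [hin]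
    rw [lintegral_lintegral_swap (by fun_prop)]
    have hker : ∀ x, ∫⁻ y, K x y ∂(stdGaussian n) = 1 := fun x => by
      simp_rw [hK, ← cameronMartin_exponent_smul hm]
      exact lintegral_exp_stdGaussian _
    simp [hker]
  have h := lintegral_mono_ae hpt
  rw [hone, lintegral_const, measure_univ, mul_one, ENNReal.ofReal_le_one] at h
  linarith

/-- Transport bound for a given coupling partner `x` of the input `v`. -/
lemma ofReal_meanLogLik_sub_le (hm : 0 < m) (hP : IsUniformSphere n (√n) P) {v : Fin n → ℝ}
    (hv : ∑ i, v i ^ 2 = n) (x : Fin n → ℝ) :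
    ENNReal.ofReal (meanLogLik m P v - n * (m / 2 - log (1 + m) / 2)
        - m / 2 * ∑ i, (v i - x i) ^ 2 + 1)
      ≤ ∫⁻ y, ENNReal.ofReal (exp (√m * (∑ i, x i * y i) - m / 2 * ∑ i, x i ^ 2)) *
          ENNReal.ofReal (channelLik m P y / exp (gaussLogLik m y)) ∂(stdGaussian n) := by
  set a : Fin n → ℝ := √m • (v - x) with ha
  set c : ℝ := m / 2 * ∑ i, x i ^ 2 - m / 2 * ∑ i, v i ^ 2 with hc
  have hgm : Measurable (fun y => log (channelLik m P y) - gaussLogLik m y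
      - (∑ i, a i * y i + c)) :=
    ((measurable_log_channelLik hP).sub (measurable_gaussLogLik m n)).sub (by fun_prop)
  have hI1 := integrable_log_channelLik_add hm hP (√m • v)
  have hI2 := integrable_gaussLogLik_add m (√m • v)
  have hI3 := (integrable_sum_mul_add_stdGaussian a (√m • v)).add (integrable_const c)
  have h := ofReal_integral_add_one_le (√m • v) hgm ((hI1.sub hI2).sub hI3)
  have hval : ∫ z, (log (channelLik m P (√m • v + z)) - gaussLogLik m (√m • v + z)
      - (∑ i, a i * (√m • v + z) i + c)) ∂(stdGaussian n)
      = meanLogLik m P v - n * (m / 2 - log (1 + m) / 2) - m / 2 * ∑ i, (v i - x i) ^ 2 := by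
    have hs : ∑ i, a i * (√m • v) i + c = m / 2 * ∑ i, (v i - x i) ^ 2 := by
      simp only [ha, hc, Finset.mul_sum, ← Finset.sum_sub_distrib, ← Finset.sum_add_distrib]
      refine Finset.sum_congr rfl fun i _ => ?_
      simp only [Pi.smul_apply, Pi.sub_apply, smul_eq_mul]
      linear_combination (v i - x i) * v i * sq_sqrt hm.le
    have hsum : ∫ z, (∑ i, a i * (√m • v + z) i + c) ∂(stdGaussian n)
        = m / 2 * ∑ i, (v i - x i) ^ 2 := by
      rw [integral_add (integrable_sum_mul_add_stdGaussian a _) (integrable_const c),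
        integral_sum_mul_add_stdGaussian, integral_const, probReal_univ, one_smul, hs]
    have hsplit := integral_sub (hI1.sub hI2) hI3
    have hsplit2 := integral_sub hI1 hI2
    simp only [Pi.sub_apply, Pi.add_apply] at hsplit hsplit2 hsum ⊢
    rw [hsplit, hsplit2, hsum, meanLogLik]
    have hG := integral_gaussLogLik_add hm hv
    rw [hG]
  rw [hval] at h
  refine h.trans (le_of_eq (lintegral_congr fun y => ?_))
  rw [cameronMartin_exponent_smul hm, ← ENNReal.ofReal_mul (exp_pos _).le,
    ← ENNReal.ofReal_mul (exp_pos _).le, ← exp_add]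
  nth_rw 2 [← exp_log (channelLik_pos hm hP y)]
  rw [← exp_sub, ← exp_add]
  congr 2
  have hay : ∑ i, a i * y i = √m * (∑ i, v i * y i) - √m * ∑ i, x i * y i := by
    rw [← mul_sub, ← Finset.sum_sub_distrib, Finset.mul_sum]
    refine Finset.sum_congr rfl fun i _ => ?_
    simp only [ha, Pi.smul_apply, Pi.sub_apply, smul_eq_mul]
    ring
  rw [hay, hc]
  ring

lemma lintegral_channelLik (hm : 0 < m) (hP : IsUniformSphere n (√n) P) :
    ∫⁻ y, ENNReal.ofReal (channelLik m P y) ∂(stdGaussian n) = 1 := by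
  have := hP.1
  simp_rw [ofReal_channelLik hm hP]
  rw [lintegral_lintegral_swap (by fun_prop)]
  simp_rw [← cameronMartin_exponent_smul hm, lintegral_exp_stdGaussian]
  simp

lemma lintegral_transport_eq_one (hm : 0 < m) (hP : IsUniformSphere n (√n) P) :
    ∫⁻ x, ∫⁻ y, ENNReal.ofReal (exp (√m * (∑ i, x i * y i) - m / 2 * ∑ i, x i ^ 2)) *
      ENNReal.ofReal (channelLik m P y / exp (gaussLogLik m y))
        ∂(stdGaussian n) ∂(stdGaussian n) = 1 := by
  have := hP.1
  set R : (Fin n → ℝ) → ENNReal := fun y =>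
    ENNReal.ofReal (channelLik m P y / exp (gaussLogLik m y)) with hR
  have hRm : Measurable R :=
    ((measurable_channelLik m P).div (measurable_gaussLogLik m n).exp).ennreal_ofReal
  change ∫⁻ x, ∫⁻ y, ENNReal.ofReal (exp (√m * (∑ i, x i * y i) - m / 2 * ∑ i, x i ^ 2)) * R y
    ∂(stdGaussian n) ∂(stdGaussian n) = 1
  rw [lintegral_lintegral_swap (by fun_prop), ← lintegral_channelLik hm hP]
  refine lintegral_congr fun y => ?_
  rw [lintegral_mul_const _ (by fun_prop), lintegral_channel_stdGaussian hm, hR,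
    ← ENNReal.ofReal_mul (exp_pos _).le, mul_div_cancel₀ _ (exp_pos _).ne']

end Sphere

lemma sq_enorm' {n : ℕ} (x : Fin n → ℝ) : enorm' x ^ 2 = ∑ i, x i ^ 2 :=
  sq_sqrt (Finset.sum_nonneg fun i _ => sq_nonneg (x i))

lemma ae_enorm'_pos {n : ℕ} (hn : 1 ≤ n) : ∀ᵐ x ∂(stdGaussian n), 0 < enorm' x := by
  have h : ∀ᵐ x ∂(stdGaussian n), x ⟨0, hn⟩ ≠ 0 := by
    have hq : ∀ᵐ t ∂(ProbabilityTheory.gaussianReal 0 1), t ≠ 0 := by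
      have := ProbabilityTheory.nullSingletonClass_gaussianReal (μ := 0) (v := 1) one_ne_zero
      simp [ae_iff]
    exact (measurePreserving_eval (fun _ : Fin n => ProbabilityTheory.gaussianReal 0 1)
      ⟨0, hn⟩).quasiMeasurePreserving.ae hq
  filter_upwards [h] with x hx
  exact sqrt_pos.2 (Finset.sum_pos' (fun i _ => sq_nonneg _)
    ⟨⟨0, hn⟩, Finset.mem_univ _, by positivity⟩)

lemma sum_sq_smul_div_enorm' {n : ℕ} {x : Fin n → ℝ} (hx : 0 < enorm' x) :
    ∑ i, (√n * x i / enorm' x) ^ 2 = n := by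
  simp_rw [div_pow, mul_pow, sq_sqrt (Nat.cast_nonneg n)]
  rw [← Finset.sum_div, ← Finset.mul_sum, ← sq_enorm']
  field_simp

lemma sum_sq_smul_div_enorm'_sub {n : ℕ} {x : Fin n → ℝ} (hx : 0 < enorm' x) :
    ∑ i, (√n * x i / enorm' x - x i) ^ 2 = (enorm' x - √n) ^ 2 := by
  have : ∀ i, (√n * x i / enorm' x - x i) ^ 2 = (√n / enorm' x - 1) ^ 2 * x i ^ 2 := fun i => by
    ring
  simp_rw [this]
  rw [← Finset.mul_sum, ← sq_enorm']
  field_simp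
  ring

lemma measurable_enorm' (n : ℕ) : Measurable (fun x : Fin n → ℝ => enorm' x) := by
  unfold enorm'
  fun_prop

lemma sq_enorm'_sub_le {n : ℕ} (x : Fin n → ℝ) :
    (enorm' x - √n) ^ 2 ≤ ∑ i, x i ^ 2 + n := by
  have h1 : 0 ≤ enorm' x * √n := mul_nonneg (sqrt_nonneg _) (sqrt_nonneg _)
  nlinarith [sq_enorm' x, sq_sqrt (Nat.cast_nonneg (α := ℝ) n)]

lemma integrable_sq_enorm'_sub (n : ℕ) :
    Integrable (fun x => (enorm' x - √n) ^ 2) (stdGaussian n) := by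
  refine (integrable_sum_sq_stdGaussian.add (integrable_const (n : ℝ))).mono'
    (((measurable_enorm' n).sub_const _).pow_const 2).aestronglyMeasurable
    (ae_of_all _ fun x => ?_)
  rw [norm_of_nonneg (sq_nonneg _)]
  exact sq_enorm'_sub_le x

lemma integral_sq_enorm'_sub_le (n : ℕ) :
    ∫ x, (enorm' x - √n) ^ 2 ∂(stdGaussian n) ≤ 2 * n := by
  calc ∫ x, (enorm' x - √n) ^ 2 ∂(stdGaussian n)
      ≤ ∫ x, (∑ i, x i ^ 2 + (n : ℝ)) ∂(stdGaussian n) :=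
        integral_mono (integrable_sq_enorm'_sub n)
          (integrable_sum_sq_stdGaussian.add (integrable_const _)) sq_enorm'_sub_le
    _ = 2 * n := by
        rw [integral_add integrable_sum_sq_stdGaussian (integrable_const _),
          integral_sum_sq_stdGaussian]
        simp only [integral_const, probReal_univ, one_smul]
        ring

lemma meanLogLik_sub_le {m : ℝ} (hm : 0 < m) {n : ℕ} (hn : 1 ≤ n) {P : Measure (Fin n → ℝ)}
    (hP : IsUniformSphere n (√n) P) {v : Fin n → ℝ} (hv : ∑ i, v i ^ 2 = n) :
    meanLogLik m P v - n * (m / 2 - log (1 + m) / 2)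
      ≤ m / 2 * ∫ x, (enorm' x - √n) ^ 2 ∂(stdGaussian n) := by
  set D := meanLogLik m P v - n * (m / 2 - log (1 + m) / 2)
  have hi := (integrable_sq_enorm'_sub n).const_mul (m / 2)
  have hi1 : Integrable (fun x => D - m / 2 * (enorm' x - √n) ^ 2) (stdGaussian n) :=
    (integrable_const D).sub hi
  have hi2 : Integrable (fun x => D - m / 2 * (enorm' x - √n) ^ 2 + 1) (stdGaussian n) :=
    hi1.add (integrable_const 1)
  have hb : ∫⁻ x, ENNReal.ofReal (D - m / 2 * (enorm' x - √n) ^ 2 + 1) ∂(stdGaussian n) ≤ 1 := by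
    rw [← lintegral_transport_eq_one hm hP]
    refine lintegral_mono_ae ?_
    filter_upwards [ae_enorm'_pos hn] with x hx
    have hw := sum_sq_smul_div_enorm' hx
    have h := ofReal_meanLogLik_sub_le hm hP hw x
    rw [sum_sq_smul_div_enorm'_sub hx, meanLogLik_eq_of_sum_sq_eq hP (hw.trans hv.symm)] at h
    exact h
  have h := (ofReal_integral_le_lintegral_ofReal hi2).trans hb
  rw [ENNReal.ofReal_le_one, integral_add hi1 (integrable_const _), integral_sub (integrable_const D) hi, integral_const_mul] at h
  simp only [integral_const, probReal_univ, one_smul] at h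
  linarith

lemma gaussSphereFreeEntropy_eq {m : ℝ} {n : ℕ} (hn : 1 ≤ n) {P : Measure (Fin n → ℝ)}
    (hP : IsUniformSphere n (√n) P) {v : Fin n → ℝ} (hv : ∑ i, v i ^ 2 = n) :
    gaussSphereFreeEntropy m n P = 1 / n * meanLogLik m P v := by
  unfold gaussSphereFreeEntropy
  congr 1
  rw [← one_smul ℝ (meanLogLik m P v), ← probReal_univ (μ := stdGaussian n), ← integral_const]
  refine integral_congr_ae ?_
  filter_upwards [ae_enorm'_pos hn] with x hx
  exact meanLogLik_eq_of_sum_sq_eq hP ((sum_sq_smul_div_enorm' hx).trans hv.symm)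

/-- For `m > 0` and `n ≥ 1`, the free entropy `f̃ₙ` of the spherical
channel satisfies `|m/2 − ln(1+m)/2 − f̃ₙ| ≤ (m/√n) √(E[(‖X̃‖−√n)²])` where `X̃` is a
standard Gaussian vector in `ℝⁿ`. -/
theorem spherical_free_entropy_gaussian_bound
    (m : ℝ) (hm : 0 < m) (n : ℕ) (hn : 1 ≤ n)
    (P : Measure (Fin n → ℝ)) (hP : IsUniformSphere n (Real.sqrt n) P) :
    |m / 2 - Real.log (1 + m) / 2 - gaussSphereFreeEntropy m n P|
      ≤ (m / Real.sqrt n) *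
        Real.sqrt (∫ Xt, (enorm' Xt - Real.sqrt n) ^ 2 ∂(stdGaussian n)) := by
  obtain ⟨v, hv⟩ : ∃ v : Fin n → ℝ, ∑ i, v i ^ 2 = n := ⟨fun _ => 1, by simp⟩
  have hn0 : (0 : ℝ) < n := by exact_mod_cast hn
  have hlow := gauss_le_meanLogLik hm hP hv
  have hup := meanLogLik_sub_le hm hn hP hv
  have hW := integral_sq_enorm'_sub_le n
  have hW0 : 0 ≤ ∫ x, (enorm' x - √n) ^ 2 ∂(stdGaussian n) :=
    integral_nonneg fun x => sq_nonneg _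
  rw [gaussSphereFreeEntropy_eq hn hP hv]
  set W := ∫ x, (enorm' x - √n) ^ 2 ∂(stdGaussian n)
  set G := meanLogLik m P v
  have hs : 0 < √(n : ℝ) := sqrt_pos.2 hn0
  have hWs : √W ≤ 2 * √n := by
    rw [sqrt_le_left (by positivity), mul_pow, sq_sqrt hn0.le]
    linarith
  have heq : m / 2 - log (1 + m) / 2 - 1 / n * G
      = -((G - n * (m / 2 - log (1 + m) / 2)) / n) := by
    field_simp
    ring
  rw [heq, abs_neg, abs_of_nonneg (div_nonneg (by linarith) hn0.le), div_le_iff₀ hn0]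
  refine hup.trans ?_
  have hr : m / √n * √W * n = m * (√W * √n) := by
    nth_rw 2 [← mul_self_sqrt hn0.le]
    field_simp
  rw [hr]
  nlinarith [mul_le_mul_of_nonneg_left hWs (sqrt_nonneg W), mul_self_sqrt hW0,
    mul_le_mul_of_nonneg_left (mul_le_mul_of_nonneg_left hWs (sqrt_nonneg W)) hm.le]

end
end

section
/- Let λ, α_u, α_v, ρ_u, ρ_v > 0 and λ_IT = 1/(ρ_u ρ_v √(α_u α_v)). For every λ > 0 the extremization inf_{m_u∈[0,ρ_u]} sup_{m_v∈[0,ρ_v]} i(m_u,m_v;λ) has a unique solution (m_u*(λ), m_v*(λ)), equal to (0,0) if 0 < λ ≤ λ_IT, and equal to ( (λ² α_u α_v ρ_v² ρ_u² − 1)/(λ α_u ρ_v (1 + λ α_v ρ_v ρ_u)), (λ² α_u α_v ρ_v² ρ_u² − 1)/(λ α_v ρ_u (1 + λ α_u ρ_v ρ_u)) ) if λ > λ_IT. -/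
open Real

noncomputable section

/-- The replica-symmetric potential `i(m_u, m_v; λ)`. -/
def rsPotential (lam au av ru rv mu mv : ℝ) : ℝ :=
  lam * au * av / 2 * (ru - mu) * (rv - mv)
    + au * Real.log (1 + lam * av * ru * mv) / 2
    + av * Real.log (1 + lam * au * rv * mu) / 2

/-- `m_u ↦ sup_{m_v ∈ [0,ρ_v]} i(m_u, m_v; λ)`. -/
def rsSup (lam au av ru rv mu : ℝ) : ℝ :=
  sSup ((fun mv => rsPotential lam au av ru rv mu mv) '' Set.Icc 0 rv)

/-- `m_u^*(λ)`. -/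
def muStar (lam au av ru rv : ℝ) : ℝ :=
  if lam ≤ 1 / (ru * rv * Real.sqrt (au * av)) then 0
  else (lam ^ 2 * au * av * rv ^ 2 * ru ^ 2 - 1) / (lam * au * rv * (1 + lam * av * rv * ru))

/-- `m_v^*(λ)`. -/
def mvStar (lam au av ru rv : ℝ) : ℝ :=
  if lam ≤ 1 / (ru * rv * Real.sqrt (au * av)) then 0
  else (lam ^ 2 * au * av * rv ^ 2 * ru ^ 2 - 1) / (lam * av * ru * (1 + lam * au * rv * ru))

/-- The potential in the coordinates `x = m_u / ρ_u`, `y = m_v / ρ_v`, up to the factor `α_u / 2`;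
here `a = λ α_u ρ_u ρ_v` and `b = λ α_v ρ_u ρ_v`. -/
def scaledPotential (a b x y : ℝ) : ℝ :=
  b * (1 - x) * (1 - y) + Real.log (1 + b * y) + b / a * Real.log (1 + a * x)

/-- The value of the scaled potential at the unconstrained maximizer in `y`. -/
def scaledProfile (a b x : ℝ) : ℝ :=
  b - (1 + b) * x - Real.log (1 - x) + b / a * Real.log (1 + a * x)

theorem rsPotential_eq_scaledPotential {lam au av ru rv : ℝ} (hlam : 0 < lam) (hau : 0 < au)
    (hru : 0 < ru) (hrv : 0 < rv) (x y : ℝ) :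
    rsPotential lam au av ru rv (ru * x) (rv * y) =
      au / 2 * scaledPotential (lam * au * ru * rv) (lam * av * ru * rv) x y := by
  have h₁ : 1 + lam * av * ru * (rv * y) = 1 + lam * av * ru * rv * y := by ring
  have h₂ : 1 + lam * au * rv * (ru * x) = 1 + lam * au * ru * rv * x := by ring
  rw [rsPotential, scaledPotential, h₁, h₂]
  field_simp

theorem scaledPotential_eq_scaledProfile {a b x y : ℝ}
    (hy : (1 + b * y) * (1 - x) = 1) :
    scaledPotential a b x y = scaledProfile a b x := by
  have hlog : Real.log (1 + b * y) = -Real.log (1 - x) := by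
    rw [eq_inv_of_mul_eq_one_left hy, Real.log_inv]
  rw [scaledPotential, scaledProfile, hlog]
  linear_combination -hy

theorem scaledPotential_lt_of_ne {a b x y₀ y : ℝ} (hb : 0 < b) (hx : x < 1)
    (hy₀ : (1 + b * y₀) * (1 - x) = 1) (hy : 0 ≤ y) (hne : y ≠ y₀) :
    scaledPotential a b x y < scaledPotential a b x y₀ := by
  have hx' : 0 < 1 - x := by linarith
  have hby : 0 < 1 + b * y := by positivity
  have hne' : (1 + b * y) * (1 - x) ≠ 1 := fun h => hne <| by
    have := mul_right_cancel₀ hx'.ne' (h.trans hy₀.symm)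
    exact mul_left_cancel₀ hb.ne' (add_left_cancel this)
  have hlog := Real.log_lt_sub_one_of_pos (mul_pos hby hx') hne'
  rw [Real.log_mul hby.ne' hx'.ne'] at hlog
  rw [scaledPotential_eq_scaledProfile hy₀, scaledPotential, scaledProfile]
  linear_combination hlog

theorem hasDerivAt_scaledProfile {a b x : ℝ} (ha : 0 < a) (hx₀ : 0 ≤ x) (hx₁ : x < 1) :
    HasDerivAt (scaledProfile a b)
      (x * (a * (1 + b) * x - (a * b - 1)) / ((1 - x) * (1 + a * x))) x := by
  have h₁ : 1 - x ≠ 0 := by linarith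
  have h₂ : 1 + a * x ≠ 0 := by positivity
  have hd := ((((hasDerivAt_id x).const_mul (1 + b)).const_sub b).sub
    (((hasDerivAt_id x).const_sub 1).log h₁)).add
    (((((hasDerivAt_id x).const_mul a).const_add 1).log h₂).const_mul (b / a))
  refine hd.congr_deriv ?_
  simp only [id]
  field_simp
  ring

theorem strictMonoOn_scaledProfile {a b c : ℝ} (ha : 0 < a) (hb : 0 < b) (hc : 0 ≤ c)
    (h : a * b - 1 ≤ a * (1 + b) * c) : StrictMonoOn (scaledProfile a b) (Set.Ico c 1) := by
  refine strictMonoOn_of_deriv_pos (convex_Ico c 1)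
    (fun x hx => (hasDerivAt_scaledProfile ha (hc.trans hx.1) hx.2).continuousAt.continuousWithinAt)
    fun x hx => ?_
  rw [interior_Ico] at hx
  have hx₀ : 0 < x := hc.trans_lt hx.1
  have h₁ : 0 < 1 - x := by linarith [hx.2]
  have h₂ : a * (1 + b) * c < a * (1 + b) * x := mul_lt_mul_of_pos_left hx.1 (by positivity)
  have h₃ : 0 < a * (1 + b) * x - (a * b - 1) := by linarith
  rw [(hasDerivAt_scaledProfile ha hx₀.le hx.2).deriv]
  positivity

theorem strictAntiOn_scaledProfile {a b c : ℝ} (ha : 0 < a) (hb : 0 < b) (hc : c < 1)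
    (h : a * (1 + b) * c ≤ a * b - 1) : StrictAntiOn (scaledProfile a b) (Set.Icc 0 c) := by
  refine strictAntiOn_of_deriv_neg (convex_Icc 0 c)
    (fun x hx => (hasDerivAt_scaledProfile ha hx.1
      (hx.2.trans_lt hc)).continuousAt.continuousWithinAt)
    fun x hx => ?_
  rw [interior_Icc] at hx
  have hx₀ : 0 < x := hx.1
  have h₁ : 0 < 1 - x := by linarith [hx.2]
  have h₂ : a * (1 + b) * x < a * (1 + b) * c := mul_lt_mul_of_pos_left hx.2 (by positivity)
  have h₃ : a * (1 + b) * x - (a * b - 1) < 0 := by linarith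
  rw [(hasDerivAt_scaledProfile ha hx₀.le (hx.2.trans hc)).deriv]
  exact div_neg_of_neg_of_pos (mul_neg_of_pos_of_neg hx₀ h₃) (by positivity)

/-- Away from the optimal `x₀`, some `y ∈ [0, 1]` beats the optimal value. -/
theorem exists_scaledProfile_lt_scaledPotential {a b x₀ x : ℝ} (ha : 0 < a) (hb : 0 < b)
    (hx₀ : 0 ≤ x₀) (hx₀b : (1 + b) * x₀ < b) (hle : a * b - 1 ≤ a * (1 + b) * x₀)
    (hopt : x₀ = 0 ∨ a * (1 + b) * x₀ ≤ a * b - 1) (hx : x ∈ Set.Icc (0 : ℝ) 1) (hne : x ≠ x₀) :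
    ∃ y ∈ Set.Icc (0 : ℝ) 1, scaledProfile a b x₀ < scaledPotential a b x y := by
  have hx₀1 : x₀ < 1 := by nlinarith
  have hmono := strictMonoOn_scaledProfile ha hb hx₀ hle
  rcases le_or_gt ((1 + b) * x) b with hxb | hxb
  · have hx1 : x < 1 := by nlinarith
    have h₁ : 0 < 1 - x := by linarith
    refine ⟨x / (b * (1 - x)), ⟨div_nonneg hx.1 (by positivity), ?_⟩, ?_⟩
    · rw [div_le_one (by positivity)]
      linarith
    · rw [scaledPotential_eq_scaledProfile (by field_simp; ring)]
      rcases hne.lt_or_gt with hlt | hgt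
      · rcases hopt with h0 | hopt
        · linarith [hx.1]
        · exact strictAntiOn_scaledProfile ha hb hx₀1 hopt ⟨hx.1, hlt.le⟩ ⟨hx₀, le_rfl⟩ hlt
      · exact hmono ⟨le_rfl, hx₀1⟩ ⟨hgt.le, hx1⟩ hgt
  · refine ⟨1, by simp, ?_⟩
    have hq1 : b / (1 + b) < 1 := by rw [div_lt_one (by positivity)]; linarith
    have hqx : b / (1 + b) < x := by rw [div_lt_iff₀ (by positivity)]; linarith
    have hx₀q : x₀ < b / (1 + b) := by rw [lt_div_iff₀ (by positivity)]; linarith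
    have hq0 : 0 < b / (1 + b) := by positivity
    calc scaledProfile a b x₀ < scaledProfile a b (b / (1 + b)) :=
          hmono ⟨le_rfl, hx₀1⟩ ⟨hx₀q.le, hq1⟩ hx₀q
      _ = scaledPotential a b (b / (1 + b)) 1 :=
          (scaledPotential_eq_scaledProfile (by field_simp; ring)).symm
      _ < scaledPotential a b x 1 := by
          have hlog : Real.log (1 + a * (b / (1 + b))) < Real.log (1 + a * x) :=
            Real.log_lt_log (by positivity) (by gcongr)
          have := mul_lt_mul_of_pos_left hlog (div_pos hb ha)
          simp only [scaledPotential]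
          linarith

theorem bddAbove_rsPotential_image {lam av ru : ℝ} (au rv mu : ℝ) (hlam : 0 < lam) (hav : 0 < av)
    (hru : 0 < ru) :
    BddAbove ((fun mv => rsPotential lam au av ru rv mu mv) '' Set.Icc 0 rv) := by
  refine isCompact_Icc.bddAbove_image ?_
  unfold rsPotential
  have h : ∀ mv ∈ Set.Icc 0 rv, 1 + lam * av * ru * mv ≠ 0 := fun mv hmv => by
    have := hmv.1
    positivity
  fun_prop (disch := assumption)

/-- If `n` maximizes `i(m, ·)` and some response to `mu` beats `i(m, n)`, then `m` has a strictly
smaller supremum than `mu`. -/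
theorem rsSup_lt_rsSup {lam au av ru rv m n mu : ℝ} (hlam : 0 < lam) (hav : 0 < av)
    (hru : 0 < ru) (hn : n ∈ Set.Icc 0 rv)
    (hmax : ∀ mv ∈ Set.Icc 0 rv,
      rsPotential lam au av ru rv m mv ≤ rsPotential lam au av ru rv m n)
    (hmu : ∃ mv ∈ Set.Icc 0 rv,
      rsPotential lam au av ru rv m n < rsPotential lam au av ru rv mu mv) :
    rsSup lam au av ru rv m < rsSup lam au av ru rv mu := by
  obtain ⟨mv, hmv, hlt⟩ := hmu
  calc rsSup lam au av ru rv m ≤ rsPotential lam au av ru rv m n :=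
        csSup_le ⟨_, Set.mem_image_of_mem _ hn⟩ (by rintro _ ⟨mv', hmv', rfl⟩; exact hmax mv' hmv')
    _ < rsPotential lam au av ru rv mu mv := hlt
    _ ≤ rsSup lam au av ru rv mu :=
        le_csSup (bddAbove_rsPotential_image au rv mu hlam hav hru) (Set.mem_image_of_mem _ hmv)

theorem le_threshold_iff {lam au av ru rv : ℝ} (hlam : 0 < lam) (hau : 0 < au) (hav : 0 < av)
    (hru : 0 < ru) (hrv : 0 < rv) :
    lam ≤ 1 / (ru * rv * Real.sqrt (au * av)) ↔
      (lam * au * ru * rv) * (lam * av * ru * rv) ≤ 1 := by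
  have hs : 0 < Real.sqrt (au * av) := Real.sqrt_pos.2 (by positivity)
  have hsq : (lam * au * ru * rv) * (lam * av * ru * rv) =
      (lam * (ru * rv * Real.sqrt (au * av))) ^ 2 := by
    rw [mul_pow, mul_pow, Real.sq_sqrt (by positivity)]
    ring
  rw [le_div_iff₀ (by positivity), hsq, sq_le_one_iff₀ (by positivity)]

/-- The candidate extremizer in scaled coordinates, characterized by its optimality conditions. -/
theorem exists_scaled_extremizer {lam au av ru rv : ℝ} (hlam : 0 < lam) (hau : 0 < au)
    (hav : 0 < av) (hru : 0 < ru) (hrv : 0 < rv) {a b : ℝ} (ha : a = lam * au * ru * rv)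
    (hb : b = lam * av * ru * rv) :
    ∃ x y : ℝ, muStar lam au av ru rv = ru * x ∧ mvStar lam au av ru rv = rv * y ∧
      0 ≤ x ∧ (1 + b) * x < b ∧ y ∈ Set.Icc (0 : ℝ) 1 ∧ (1 + b * y) * (1 - x) = 1 ∧
      a * b - 1 ≤ a * (1 + b) * x ∧ (x = 0 ∨ a * (1 + b) * x ≤ a * b - 1) := by
  have ha₀ : 0 < a := by rw [ha]; positivity
  have hb₀ : 0 < b := by rw [hb]; positivity
  have hiff := le_threshold_iff hlam hau hav hru hrv
  rw [← ha, ← hb] at hiff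
  by_cases hab : a * b ≤ 1
  · refine ⟨0, 0, ?_, ?_, le_rfl, by simpa using hb₀, by simp, by simp, by simpa using hab,
      Or.inl rfl⟩
    · rw [muStar, if_pos (hiff.2 hab), mul_zero]
    · rw [mvStar, if_pos (hiff.2 hab), mul_zero]
  · have hn : ¬ lam ≤ 1 / (ru * rv * Real.sqrt (au * av)) := fun h => hab (hiff.1 h)
    have hpos : 0 ≤ a * b - 1 := by linarith
    have hmul : a * (1 + b) * ((a * b - 1) / (a * (1 + b))) = a * b - 1 :=
      mul_div_cancel₀ _ (by positivity)
    refine ⟨(a * b - 1) / (a * (1 + b)), (a * b - 1) / (b * (1 + a)), ?_, ?_,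
      by positivity, ?_, ⟨by positivity, ?_⟩, ?_, hmul.ge, Or.inr hmul.le⟩
    · have h : 1 + lam * av * rv * ru = 1 + b := by rw [hb]; ring
      rw [muStar, if_neg hn, h, ha, mul_div_assoc', div_eq_div_iff (by positivity) (by positivity),
        hb]
      ring
    · have h : 1 + lam * au * rv * ru = 1 + a := by rw [ha]; ring
      rw [mvStar, if_neg hn, h, hb, mul_div_assoc', div_eq_div_iff (by positivity) (by positivity),
        ha]
      ring
    · refine lt_of_mul_lt_mul_left ?_ ha₀.le
      linarith
    · rw [div_le_one (by positivity)]
      linarith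
    · field_simp
      ring

/-- **unique extremizer of the replica potential.**
For every `λ > 0`, the pair `(m_u^*(λ), m_v^*(λ))` — equal to `(0,0)` for
`λ ≤ λ_IT = 1/(ρ_uρ_v√(α_uα_v))` and to the explicit formulas for `λ > λ_IT` — is the
unique solution of `inf_{m_u ∈ [0,ρ_u]} sup_{m_v ∈ [0,ρ_v]} i(m_u,m_v;λ)`:
`m_u^*(λ)` is the unique global minimizer over `[0,ρ_u]` of
`m_u ↦ sup_{m_v ∈ [0,ρ_v]} i(m_u,m_v;λ)`, and `m_v^*(λ)` is the unique global
maximizer over `[0,ρ_v]` of `m_v ↦ i(m_u^*(λ),m_v;λ)`. -/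
theorem rs_potential_unique_extremizer
    (au av ru rv : ℝ) (hau : 0 < au) (hav : 0 < av) (hru : 0 < ru) (hrv : 0 < rv)
    (lam : ℝ) (hlam : 0 < lam) :
    (muStar lam au av ru rv ∈ Set.Icc 0 ru ∧
      (∀ mu ∈ Set.Icc 0 ru,
        rsSup lam au av ru rv (muStar lam au av ru rv) ≤ rsSup lam au av ru rv mu) ∧
      (∀ mu ∈ Set.Icc 0 ru, mu ≠ muStar lam au av ru rv →
        rsSup lam au av ru rv (muStar lam au av ru rv) < rsSup lam au av ru rv mu)) ∧
    (mvStar lam au av ru rv ∈ Set.Icc 0 rv ∧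
      (∀ mv ∈ Set.Icc 0 rv,
        rsPotential lam au av ru rv (muStar lam au av ru rv) mv
          ≤ rsPotential lam au av ru rv (muStar lam au av ru rv)
              (mvStar lam au av ru rv)) ∧
      (∀ mv ∈ Set.Icc 0 rv, mv ≠ mvStar lam au av ru rv →
        rsPotential lam au av ru rv (muStar lam au av ru rv) mv
          < rsPotential lam au av ru rv (muStar lam au av ru rv)
              (mvStar lam au av ru rv))) := by
  obtain ⟨x, y, hmu, hmv, hx, hxb, hy, hxy, hle, hopt⟩ :=
    exists_scaled_extremizer hlam hau hav hru hrv rfl rfl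
  have ha : 0 < lam * au * ru * rv := by positivity
  have hb : 0 < lam * av * ru * rv := by positivity
  have hx1 : x < 1 := by nlinarith
  rw [hmu, hmv]
  have hyIcc : rv * y ∈ Set.Icc 0 rv :=
    ⟨mul_nonneg hrv.le hy.1, mul_le_of_le_one_right hrv.le hy.2⟩
  have hmax : ∀ mv ∈ Set.Icc 0 rv, mv ≠ rv * y →
      rsPotential lam au av ru rv (ru * x) mv < rsPotential lam au av ru rv (ru * x) (rv * y) := by
    intro mv hmv hne
    obtain ⟨z, rfl⟩ : ∃ z, mv = rv * z := ⟨mv / rv, (mul_div_cancel₀ mv hrv.ne').symm⟩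
    rw [rsPotential_eq_scaledPotential hlam hau hru hrv,
      rsPotential_eq_scaledPotential hlam hau hru hrv]
    exact mul_lt_mul_of_pos_left (scaledPotential_lt_of_ne hb hx1 hxy
      (nonneg_of_mul_nonneg_right hmv.1 hrv) fun h => hne (h ▸ rfl)) (by positivity)
  have hmaxle : ∀ mv ∈ Set.Icc 0 rv,
      rsPotential lam au av ru rv (ru * x) mv ≤ rsPotential lam au av ru rv (ru * x) (rv * y) := by
    intro mv hmv
    rcases eq_or_ne mv (rv * y) with rfl | hne
    · exact le_rfl
    · exact (hmax mv hmv hne).le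
  have hmin : ∀ mu ∈ Set.Icc 0 ru, mu ≠ ru * x →
      rsSup lam au av ru rv (ru * x) < rsSup lam au av ru rv mu := by
    intro mu hmu hne
    obtain ⟨w, rfl⟩ : ∃ w, mu = ru * w := ⟨mu / ru, (mul_div_cancel₀ mu hru.ne').symm⟩
    have hw : w ∈ Set.Icc (0 : ℝ) 1 :=
      ⟨nonneg_of_mul_nonneg_right hmu.1 hru, le_of_mul_le_mul_left (by linarith [hmu.2]) hru⟩
    obtain ⟨z, hz, hlt⟩ := exists_scaledProfile_lt_scaledPotential ha hb hx hxb hle hopt hw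
      fun h => hne (h ▸ rfl)
    refine rsSup_lt_rsSup hlam hav hru hyIcc hmaxle
      ⟨rv * z, ⟨mul_nonneg hrv.le hz.1, mul_le_of_le_one_right hrv.le hz.2⟩, ?_⟩
    rw [rsPotential_eq_scaledPotential hlam hau hru hrv,
      rsPotential_eq_scaledPotential hlam hau hru hrv, scaledPotential_eq_scaledProfile hxy]
    exact mul_lt_mul_of_pos_left hlt (by positivity)
  refine ⟨⟨⟨by positivity, mul_le_of_le_one_right hru.le hx1.le⟩, fun mu hmu => ?_, hmin⟩,
    hyIcc, hmaxle, hmax⟩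
  rcases eq_or_ne mu (ru * x) with rfl | hne
  · exact le_rfl
  · exact (hmin mu hmu hne).le

end
end

section
/- Let g and G be two differentiable convex functions defined on an interval I ⊆ ℝ. Let r ∈ I and δ > 0 such that r + δ ∈ I and r − δ ∈ I. Then |G'(r) − g'(r)| ≤ C_δ(r) + (1/δ) Σ_{u ∈ {−δ, 0, δ}} |G(r+u) − g(r+u)|, where C_δ(r) = g'(r+δ) − g'(r−δ) ≥ 0. -/
open Real Set

/-- A convex function lies above its tangent lines. -/
theorem ConvexOn.mul_sub_le_of_hasDerivWithinAt {s : Set ℝ} {f : ℝ → ℝ} {f' x y : ℝ}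
    (hf : ConvexOn ℝ s f) (hx : x ∈ s) (hy : y ∈ s) (hf' : HasDerivWithinAt f f' s x) :
    f' * (y - x) ≤ f y - f x := by
  rcases lt_trichotomy x y with hxy | rfl | hxy
  · have h := hf.le_slope_of_hasDerivWithinAt hx hy hxy hf'
    rwa [slope_def_field, le_div_iff₀ (sub_pos.2 hxy)] at h
  · simp
  · have h := hf.slope_le_of_hasDerivWithinAt hy hx hxy hf'
    rw [slope_def_field, div_le_iff₀ (sub_pos.2 hxy)] at h
    linarith

/-- **upper bound for differentiable convex functions.**
Let `g` and `G` be differentiable convex functions on an interval `I ⊆ ℝ`, with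
derivative functions `g'` and `G'` on `I`. Let `r ∈ I` and `δ > 0` with
`r + δ ∈ I` and `r − δ ∈ I`. Then `C_δ(r) := g'(r+δ) − g'(r−δ) ≥ 0` and
`|G'(r) − g'(r)| ≤ C_δ(r) + (1/δ) Σ_{u ∈ {−δ,0,δ}} |G(r+u) − g(r+u)|`. -/
theorem convex_derivative_difference_bound
    (I : Set ℝ) (hI : Convex ℝ I)
    (g G g' G' : ℝ → ℝ)
    (hg : ConvexOn ℝ I g) (hG : ConvexOn ℝ I G)
    (hg' : ∀ x ∈ I, HasDerivWithinAt g (g' x) I x)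
    (hG' : ∀ x ∈ I, HasDerivWithinAt G (G' x) I x)
    (r δ : ℝ) (hδ : 0 < δ) (hr : r ∈ I) (hrp : r + δ ∈ I) (hrm : r - δ ∈ I) :
    0 ≤ g' (r + δ) - g' (r - δ) ∧
    |G' r - g' r| ≤ (g' (r + δ) - g' (r - δ))
      + (1 / δ) * (|G (r - δ) - g (r - δ)| + |G r - g r| + |G (r + δ) - g (r + δ)|) := by
  have hG_right := hG.mul_sub_le_of_hasDerivWithinAt hr hrp (hG' r hr)
  have hG_left := hG.mul_sub_le_of_hasDerivWithinAt hr hrm (hG' r hr)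
  have hg_right := hg.mul_sub_le_of_hasDerivWithinAt hr hrp (hg' r hr)
  have hg_left := hg.mul_sub_le_of_hasDerivWithinAt hr hrm (hg' r hr)
  have hgp := hg.mul_sub_le_of_hasDerivWithinAt hrp hr (hg' _ hrp)
  have hgm := hg.mul_sub_le_of_hasDerivWithinAt hrm hr (hg' _ hrm)
  ring_nf at hG_right hG_left hg_right hg_left hgp hgm
  obtain ⟨hm₁, hm₂⟩ := abs_le.1 (le_refl |G (r - δ) - g (r - δ)|)
  obtain ⟨h₁, h₂⟩ := abs_le.1 (le_refl |G r - g r|)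
  obtain ⟨hp₁, hp₂⟩ := abs_le.1 (le_refl |G (r + δ) - g (r + δ)|)
  refine ⟨le_of_mul_le_mul_left (by linarith) hδ, ?_⟩
  rw [one_div_mul_eq_div, ← sub_le_iff_le_add', le_div_iff₀ hδ, sub_mul, sub_le_iff_le_add,
    ← abs_of_pos hδ, ← abs_mul, abs_of_pos hδ, abs_le]
  constructor <;> linarith
end
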